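/- arXiv:1201.2212 — 3 statements merged into one kernel-verified Lean document; each statement's English description precedes it below -/
import Mathlib

section
/- Let P be a lattice d-polytope in ℝ^d. Then there exists a polynomial p with rational coefficients and degree d such that for every positive integer t, the number of lattice points in the dilate tP equals p(t), i.e., #(tP ∩ ℤ^d) = p(t). -/
open scoped Pointwise

namespace EhrhartAux

def IsRep {n d : ℕ} (w : Fin n → Fin d → ℤ) (c : Fin n → ℝ) (t : ℝ) (x : Fin d → ℝ) : Prop :=
  (∀ i, 0 ≤ c i) ∧ ∑ i, c i = t ∧ ∀ j, ∑ i, c i * (w i j : ℝ) = x j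

def Ker {n d : ℕ} (w : Fin n → Fin d → ℤ) (u : Fin n → ℝ) : Prop :=
  ∑ i, u i = 0 ∧ ∀ j, ∑ i, u i * (w i j : ℝ) = 0

def LexNeg {n : ℕ} (u : Fin n → ℝ) : Prop := ∃ i, (∀ j < i, u j = 0) ∧ u i < 0

/-- Goodness only depends on the set of zeros of `c`. -/
def Good {n d : ℕ} (w : Fin n → Fin d → ℤ) (c : Fin n → ℝ) : Prop :=
  ∀ u, Ker w u → (∀ i, c i = 0 → 0 ≤ u i) → ¬ LexNeg u

lemma exists_lexmin {n : ℕ} (K : Set (Fin n → ℝ)) (hK : IsCompact K) (hne : K.Nonempty) :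
    ∃ x ∈ K, ∀ y ∈ K, ¬ LexNeg (y - x) := by
  have key : ∀ m : ℕ, ∃ x ∈ K, ∀ y ∈ K, ∀ i : Fin n, (i : ℕ) < m →
      (∀ j < i, y j = x j) → x i ≤ y i := by
    intro m
    induction m with
    | zero =>
      obtain ⟨x, hx⟩ := hne
      exact ⟨x, hx, fun y _ i hi => absurd hi (Nat.not_lt_zero _)⟩
    | succ m ih =>
      obtain ⟨x, hx, hmin⟩ := ih
      by_cases hm : m < n
      · set K' : Set (Fin n → ℝ) := K ∩ ⋂ j : Fin n, ⋂ _ : (j : ℕ) < m, {y | y j = x j} with hK'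
        have hK'c : IsCompact K' := by
          apply hK.inter_right
          refine isClosed_iInter fun j => isClosed_iInter fun _ => ?_
          exact isClosed_eq (continuous_apply j) continuous_const
        have hxK' : x ∈ K' := ⟨hx, by simp⟩
        obtain ⟨z, hz, hzmin⟩ := hK'c.exists_isMinOn ⟨x, hxK'⟩
          (continuous_apply (⟨m, hm⟩ : Fin n)).continuousOn
        have hzx : ∀ j : Fin n, (j : ℕ) < m → z j = x j := by
          have := hz.2
          simpa using this
        refine ⟨z, hz.1, fun y hy i hi hyz => ?_⟩
        rcases Nat.lt_succ_iff_lt_or_eq.1 hi with h | h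
        · rw [hzx i h]
          refine hmin y hy i h fun j hj => ?_
          rw [hyz j hj, hzx j (lt_trans (by exact_mod_cast hj) h)]
        · have hi' : i = ⟨m, hm⟩ := Fin.ext h
          subst hi'
          refine hzmin (a := y) ⟨hy, ?_⟩
          simp only [Set.mem_iInter]
          intro j hj
          have := hyz j (by exact_mod_cast hj)
          simp [this, hzx j hj]
      · refine ⟨x, hx, fun y hy i _ h => hmin y hy i (by have := i.2; omega) h⟩
  obtain ⟨x, hx, h⟩ := key n
  refine ⟨x, hx, fun y hy ⟨i, hi, hneg⟩ => ?_⟩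
  have := h y hy i i.2 (fun j hj => by have := hi j hj; simp at this; linarith)
  simp at hneg
  linarith

lemma lexneg_or {n : ℕ} (u : Fin n → ℝ) (h1 : ¬ LexNeg u) (h2 : ¬ LexNeg (-u)) : u = 0 := by
  by_contra hne
  have hex : ∃ i, u i ≠ 0 := by
    by_contra hh
    push Not at hh
    exact hne (funext hh)
  obtain ⟨i, hi, hmin⟩ := (wellFounded_lt (α := Fin n)).has_min {i | u i ≠ 0} hex
  have hz : ∀ j < i, u j = 0 := fun j hj => by
    by_contra h
    exact hmin j h hj
  rcases lt_or_gt_of_ne (show u i ≠ 0 from hi) with h | h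
  · exact h1 ⟨i, hz, h⟩
  · exact h2 ⟨i, fun j hj => by simp [hz j hj], by simpa using h⟩

lemma ker_sub {n d : ℕ} {w : Fin n → Fin d → ℤ} {c c' : Fin n → ℝ} 
    (h1 : ∑ i, c i = ∑ i, c' i)
    (h2 : ∀ j, ∑ i, c i * (w i j : ℝ) = ∑ i, c' i * (w i j : ℝ)) : Ker w (c - c') := by
  constructor
  · simp [Finset.sum_sub_distrib, h1]
  · intro j
    simp [sub_mul, Finset.sum_sub_distrib, h2 j]

lemma good_unique {n d : ℕ} {w : Fin n → Fin d → ℤ} {c c' : Fin n → ℝ} 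
    (hc : ∀ i, 0 ≤ c i) (hc' : ∀ i, 0 ≤ c' i)
    (h1 : ∑ i, c i = ∑ i, c' i)
    (h2 : ∀ j, ∑ i, c i * (w i j : ℝ) = ∑ i, c' i * (w i j : ℝ))
    (g : Good w c) (g' : Good w c') : c = c' := by
  have := lexneg_or (c - c')
    (g' _ (ker_sub h1 h2) (fun i hi => by simp [hi, hc i]))
    (by
      rw [neg_sub]
      exact g _ (ker_sub h1.symm (fun j => (h2 j).symm)) (fun i hi => by simp [hi, hc' i]))
  exact sub_eq_zero.1 this

lemma exists_good {n d : ℕ} {w : Fin n → Fin d → ℤ} {c : Fin n → ℝ} {t : ℝ} {x : Fin d → ℝ}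
    (h : IsRep w c t x) : ∃ c', IsRep w c' t x ∧ Good w c' := by
  have hcomp : IsCompact {c | IsRep w c t x} := by
    have hsub : {c | IsRep w c t x} ⊆ Set.Icc (0 : Fin n → ℝ) (fun _ => t) := by
      intro c hc
      refine ⟨fun i => hc.1 i, fun i => ?_⟩
      rw [← hc.2.1]
      exact Finset.single_le_sum (f := c) (fun i _ => hc.1 i) (Finset.mem_univ i)
    refine isCompact_Icc.of_isClosed_subset ?_ hsub
    have : {c | IsRep w c t x} = (⋂ i, {c | 0 ≤ c i}) ∩ ({c | ∑ i, c i = t} ∩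
        ⋂ j, {c | ∑ i, c i * (w i j : ℝ) = x j}) := by
      ext c; simp [IsRep]
    rw [this]
    refine IsClosed.inter (isClosed_iInter fun i => ?_) (IsClosed.inter ?_
      (isClosed_iInter fun j => ?_))
    · exact isClosed_le continuous_const (continuous_apply i)
    · exact isClosed_eq (by fun_prop) continuous_const
    · exact isClosed_eq (by fun_prop) continuous_const
  obtain ⟨c', hc', hmin⟩ := exists_lexmin _ hcomp ⟨c, h⟩
  refine ⟨c', hc', fun u hu hz hneg => ?_⟩
  -- find small positive step
  have hev : ∀ᶠ e in nhdsWithin (0 : ℝ) (Set.Ioi 0), ∀ i, 0 ≤ c' i + e * u i := by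
    rw [Filter.eventually_all]
    intro i
    rcases (hc'.1 i).eq_or_lt with h0 | h0
    · filter_upwards [self_mem_nhdsWithin] with e he
      rw [← h0, zero_add]
      exact mul_nonneg (le_of_lt he) (hz i h0.symm)
    · have hcont : Continuous fun e : ℝ => c' i + e * u i := by fun_prop
      have := (hcont.tendsto 0).eventually (lt_mem_nhds (a := 0) (by simpa using h0))
      exact (this.filter_mono nhdsWithin_le_nhds).mono fun e he => le_of_lt he
  obtain ⟨e, he, hpos⟩ := (hev.and self_mem_nhdsWithin).exists
  have hpos : 0 < e := hpos
  refine hmin (c' + e • u) ⟨fun i => by simpa using he i, ?_, fun j => ?_⟩ ?_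
  · simp [Finset.sum_add_distrib, ← Finset.mul_sum, hu.1, hc'.2.1]
  · simp [add_mul, Finset.sum_add_distrib, mul_assoc, ← Finset.mul_sum, hu.2 j, hc'.2.2 j]
  · obtain ⟨i, h1, h2⟩ := hneg
    refine ⟨i, fun j hj => by simp [h1 j hj], ?_⟩
    simpa using mul_neg_of_pos_of_neg hpos h2

lemma good_card {n d : ℕ} {w : Fin n → Fin d → ℤ} {c : Fin n → ℝ} (g : Good w c) :
    (Finset.univ.filter fun i => c i ≠ 0).card ≤ d + 1 := by
  set T := Finset.univ.filter fun i => c i ≠ 0 with hT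
  have hind : AffineIndependent ℝ (fun i : T => fun j => (w i j : ℝ)) := by
    rw [affineIndependent_iff]
    intro s a hs ha e he
    classical
    set u : Fin n → ℝ := fun i => if h : i ∈ T then (if (⟨i, h⟩ : T) ∈ s then a ⟨i, h⟩ else 0) else 0 with hu
    have hsum : ∀ F : Fin n → ℝ, ∑ i, u i * F i = ∑ i ∈ s, a i * F i := by
      intro F
      rw [← Finset.sum_subset (Finset.subset_univ T) (by intro i _ hi; simp [hu, hi]),
        ← Finset.sum_coe_sort T]
      rw [← Finset.sum_subset (Finset.subset_univ s) (by intro i _ hi; simp [hu, hi])]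
      refine Finset.sum_congr rfl fun i hi => ?_
      simp [hu, hi]
    have hk : Ker w u := by
      refine ⟨?_, fun j => ?_⟩
      · simpa [hs] using hsum (fun _ => 1)
      · rw [hsum]
        simpa using congrFun ha j
    have hz : ∀ i, c i = 0 → u i = 0 := by
      intro i hi
      simp [hu, hT, hi]
    have hu0 : u = 0 := by
      refine lexneg_or u (g u hk fun i hi => (hz i hi).ge) (g _ ⟨?_, fun j => ?_⟩ fun i hi => by simp [hz i hi])
      · simp [hk.1]
      · simp [hk.2 j]
    have := congrFun hu0 e
    simpa [hu, he] using this
  have := hind.card_le_finrank_succ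
  have h2 := Submodule.finrank_le (vectorSpan ℝ (Set.range (fun i : T => fun j => (w i j : ℝ))))
  simp only [Fintype.card_coe, Module.finrank_fin_fun] at this h2
  omega

lemma card_piAnti {n : ℕ} (s : Finset (Fin n)) (m : ℕ) : (s.piAntidiag m).card = s.card.multichoose m := by
  rw [← Finset.card_finsuppAntidiag_nat_eq_multichoose]
  refine Finset.card_bij' (fun f _ => Finsupp.equivFunOnFinite.symm f) (fun f _ => f) ?_ ?_ ?_ ?_
  · intro f hf
    simp only [Finset.mem_piAntidiag] at hf
    simp only [Finset.mem_finsuppAntidiag]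
    refine ⟨by simpa using hf.1, fun i hi => hf.2 i (by simpa using hi)⟩
  · intro f hf
    simp only [Finset.mem_finsuppAntidiag] at hf
    simp only [Finset.mem_piAntidiag]
    refine ⟨hf.1, fun i hi => hf.2 (by simpa using hi)⟩
  · intro f hf; rfl
  · intro f hf; ext; rfl

/-- number of ways -/
def cnt {n : ℕ} (s : Finset (Fin n)) (h t : ℕ) : ℕ :=
  if h ≤ t then (s.piAntidiag (t - h)).card else 0

lemma cnt_poly {n : ℕ} (s : Finset (Fin n)) (h : ℕ) (hs : h ≤ s.card) :
    ∃ p : Polynomial ℚ, p.natDegree ≤ s.card - 1 ∧ ∀ t : ℕ, 0 < t → (cnt s h t : ℚ) = p.eval (t : ℚ) := by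
  rcases Nat.eq_zero_or_pos s.card with h0 | h0
  · refine ⟨0, by simp, fun t ht => ?_⟩
    have hs0 : s = ∅ := Finset.card_eq_zero.1 h0
    have : h = 0 := by omega
    subst this hs0
    simp only [cnt]
    rw [if_pos (Nat.zero_le _), Finset.piAntidiag_empty_of_ne_zero (by omega)]
    simp
  · obtain ⟨k, hk⟩ : ∃ k, s.card = k + 1 := ⟨s.card - 1, by omega⟩
    refine ⟨Polynomial.C ((k.factorial : ℚ)⁻¹) * (descPochhammer ℚ k).comp
      (Polynomial.X + Polynomial.C ((k : ℚ) - h)), ?_, ?_⟩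
    · refine (Polynomial.natDegree_C_mul_le _ _).trans ?_
      rw [Polynomial.natDegree_comp, descPochhammer_natDegree, Polynomial.natDegree_X_add_C]
      simp [hk]
    · intro t ht
      have hev : ((t : ℚ) + ((k : ℚ) - h)) = ((t + k - h : ℕ) : ℚ) := by
        rw [Nat.cast_sub (by omega)]; push_cast; ring
      simp only [Polynomial.eval_mul, Polynomial.eval_C, Polynomial.eval_comp, Polynomial.eval_add,
        Polynomial.eval_X]
      rw [hev, descPochhammer_eval_eq_descFactorial, Nat.descFactorial_eq_factorial_mul_choose]
      have hf : (k.factorial : ℚ) ≠ 0 := by exact_mod_cast k.factorial_ne_zero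
      push_cast
      rw [inv_mul_cancel_left₀ hf]
      norm_cast
      unfold cnt
      split_ifs with hle
      · rw [card_piAnti, Nat.multichoose_eq, hk]
        rw [show k + 1 + (t - h) - 1 = (t - h) + k by omega, show t + k - h = (t - h) + k by omega]
        exact Nat.choose_symm_add
      · rw [Nat.choose_eq_zero_of_lt (by omega)]


/-- box points -/
def Box {n d : ℕ} (w : Fin n → Fin d → ℤ) : Set (Fin n → ℝ) :=
  {f | (∀ i, 0 ≤ f i ∧ f i ≤ 1) ∧ Good w f ∧ (∃ h : ℕ, ∑ i, f i = h) ∧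
    ∃ x : Fin d → ℤ, ∀ j, ∑ i, f i * (w i j : ℝ) = x j}

lemma box_finite {n d : ℕ} (w : Fin n → Fin d → ℤ) : (Box w).Finite := by
  classical
  set B : Fin d → ℤ := fun j => ∑ i, |w i j| with hB
  set F : (Fin n → ℝ) → ℤ × (Fin d → ℤ) := fun f =>
    (⌊∑ i, f i⌋, fun j => ⌊∑ i, f i * (w i j : ℝ)⌋) with hF
  refine Set.Finite.of_finite_image (f := F) ?_ ?_
  · refine (Set.finite_Icc ((0 : ℤ), -B) ((n : ℤ), B)).subset ?_
    rintro _ ⟨f, ⟨h1, -, ⟨h, hh⟩, x, hx⟩, rfl⟩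
    have hb : ∀ j, |∑ i, f i * (w i j : ℝ)| ≤ B j := by
      intro j
      refine (Finset.abs_sum_le_sum_abs _ _).trans ?_
      simp only [hB]
      push_cast
      refine Finset.sum_le_sum fun i _ => ?_
      rw [abs_mul, abs_of_nonneg (h1 i).1]
      exact mul_le_of_le_one_left (abs_nonneg _) (h1 i).2
    have hn : ∑ i, f i ≤ n := by
      calc ∑ i, f i ≤ ∑ i : Fin n, (1 : ℝ) := Finset.sum_le_sum fun i _ => (h1 i).2
        _ = n := by simp
    simp only [hF, Set.mem_Icc, Prod.le_def, Pi.le_def]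
    refine ⟨⟨?_, fun j => ?_⟩, ?_, fun j => ?_⟩
    · exact Int.floor_nonneg.2 (Finset.sum_nonneg fun i _ => (h1 i).1)
    · have := (abs_le.1 (hb j)).1
      rw [hx j] at this ⊢
      rw [Int.floor_intCast]
      simp only [Pi.neg_apply]
      exact_mod_cast this
    · rw [hh] at hn ⊢
      simp only [Int.floor_natCast]
      exact_mod_cast hn
    · have := (abs_le.1 (hb j)).2
      rw [hx j] at this ⊢
      rw [Int.floor_intCast]
      exact_mod_cast this
  · rintro f ⟨h1, g, ⟨h, hh⟩, x, hx⟩ f' ⟨h1', g', ⟨h', hh'⟩, x', hx'⟩ heq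
    simp only [hF, hh, hh', hx, hx', Prod.mk.injEq, Int.floor_natCast, Int.floor_intCast] at heq
    refine good_unique (fun i => (h1 i).1) (fun i => (h1' i).1) ?_ (fun j => ?_) g g'
    · rw [hh, hh']; exact_mod_cast heq.1
    · rw [hx, hx', congrFun heq.2 j]

lemma good_of_zeros {n d : ℕ} {w : Fin n → Fin d → ℤ} {c c' : Fin n → ℝ}
    (h : ∀ i, c i = 0 → c' i = 0) (g : Good w c) : Good w c' :=
  fun u hu hz => g u hu fun i hi => hz i (h i hi)

/-- The translates. -/
def Tr {n : ℕ} (f : Fin n → ℝ) (t : ℕ) : Type :=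
  {m : Fin n → ℕ // (∀ i, f i = 0 → m i = 0) ∧ ∑ i, f i + ∑ i, (m i : ℝ) = t}

lemma card_tr {n : ℕ} (f : Fin n → ℝ) (h : ℕ) (hf : ∑ i, f i = h) (t : ℕ) :
    Finite (Tr f t) ∧ Nat.card (Tr f t) = cnt (Finset.univ.filter fun i => f i ≠ 0) h t := by
  classical
  by_cases hle : h ≤ t
  · have e : Tr f t ≃ ((Finset.univ.filter fun i => f i ≠ 0).piAntidiag (t - h) : Finset (Fin n → ℕ)) := by
      refine Equiv.subtypeEquivRight fun m => ?_
      rw [Finset.mem_piAntidiag, hf]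
      have hc : ((h : ℝ) + ∑ i, (m i : ℝ) = t) ↔ h + ∑ i, m i = t := by
        exact_mod_cast Iff.rfl
      rw [and_comm, hc]
      · constructor
        · rintro ⟨h1, h2⟩
          refine ⟨?_, fun i hi => by simpa using fun h => hi (h2 i h)⟩
          rw [Finset.sum_filter_of_ne]
          · omega
          · intro i _ hi h; exact hi (h2 i h)
        · rintro ⟨h1, h2⟩
          have h3 : ∀ i, f i = 0 → m i = 0 := fun i hi => by
            by_contra hne
            simpa [hi] using h2 i hne
          refine ⟨?_, h3⟩
          rw [Finset.sum_filter_of_ne] at h1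
          · omega
          · intro i _ hi h; exact hi (h3 i h)
    refine ⟨Finite.of_equiv _ e.symm, ?_⟩
    rw [Nat.card_congr e, cnt, if_pos hle, Nat.card_eq_fintype_card, Fintype.card_coe]
  · have : IsEmpty (Tr f t) := by
      refine ⟨fun ⟨m, _, hm⟩ => hle ?_⟩
      rw [hf] at hm
      have : h + ∑ i, m i = t := by exact_mod_cast hm
      omega
    refine ⟨inferInstance, ?_⟩
    rw [cnt, if_neg hle, Nat.card_of_isEmpty]

lemma count_eq {n d : ℕ} (w : Fin n → Fin d → ℤ) (t : ℕ) :
    Nat.card {x : Fin d → ℤ // ∃ c, IsRep w c t (fun i => (x i : ℝ))} =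
      Nat.card (Σ f : Box w, Tr f.1 t) := by
  symm
  have hxs : ∀ a : (Σ f : Box w, Tr f.1 t), ∃ x : Fin d → ℤ,
      IsRep w (fun i => a.1.1 i + a.2.1 i) t (fun i => (x i : ℝ)) := by
    rintro ⟨⟨f, h1, g, hh, x, hx⟩, m, hm1, hm2⟩
    refine ⟨fun j => x j + ∑ i, m i * w i j, fun i => ?_, ?_, fun j => ?_⟩
    · have := (h1 i).1
      positivity
    · simpa [Finset.sum_add_distrib] using hm2
    · simp [add_mul, Finset.sum_add_distrib, hx j]
  choose X hX using hxs
  refine Nat.card_congr (Equiv.ofBijective (fun a => ⟨X a, _, hX a⟩) ⟨?_, ?_⟩)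
  · intro a b hab
    simp only [Subtype.mk.injEq] at hab
    have ha := hX a
    have hb := hX b
    rw [hab] at ha
    obtain ⟨⟨f, h1, g, hh, x, hx⟩, m, hm1, hm2⟩ := a
    obtain ⟨⟨f', h1', g', hh', x', hx'⟩, m', hm1', hm2'⟩ := b
    clear hX hab
    simp only at ha hb
    have hz : ∀ i, f i = 0 → f i + m i = 0 := fun i hi => by simp [hi, hm1 i hi]
    have hz' : ∀ i, f' i = 0 → f' i + m' i = 0 := fun i hi => by simp [hi, hm1' i hi]
    have heq := good_unique ha.1 hb.1 (ha.2.1.trans hb.2.1.symm)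
      (fun j => (ha.2.2 j).trans (hb.2.2 j).symm) (good_of_zeros hz g) (good_of_zeros hz' g')
    have hm : m = m' := by
      funext i
      have hi : f i + m i = f' i + m' i := congrFun heq i
      have a1 := h1 i
      have a2 := h1' i
      rcases a1.1.eq_or_lt with h | h
      · have : (m i : ℝ) = 0 := by simp [hm1 i h.symm]
        rw [← h, this] at hi
        have b1 : (0 : ℝ) ≤ m' i := Nat.cast_nonneg _
        have : (m' i : ℝ) = 0 := by linarith
        have : m' i = 0 := by exact_mod_cast this
        rw [this, hm1 i h.symm]
      · rcases a2.1.eq_or_lt with h' | h'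
        · have : (m' i : ℝ) = 0 := by simp [hm1' i h'.symm]
          have b1 : (0 : ℝ) ≤ m i := Nat.cast_nonneg _
          linarith
        · have e1 : (m i : ℝ) < m' i + 1 := by linarith
          have e2 : (m' i : ℝ) < m i + 1 := by linarith
          have e1' : m i < m' i + 1 := by exact_mod_cast e1
          have e2' : m' i < m i + 1 := by exact_mod_cast e2
          omega
    have hf : f = f' := by
      funext i
      have hi : f i + m i = f' i + m' i := congrFun heq i
      rw [hm] at hi
      linarith
    subst hm hf
    rfl
  · rintro ⟨x, c, hc⟩
    obtain ⟨c', hc', g⟩ := exists_good hc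
    set m : Fin n → ℕ := fun i => ⌈c' i⌉₊ - 1 with hm
    have hmz : ∀ i, c' i = 0 → m i = 0 := fun i hi => by simp [hm, hi]
    have hmc : ∀ i, 0 < c' i → (m i : ℝ) < c' i ∧ c' i ≤ m i + 1 := by
      intro i hi
      have h1 : 1 ≤ ⌈c' i⌉₊ := Nat.one_le_iff_ne_zero.2 (by simpa using hi)
      have h2 := Nat.le_ceil (c' i)
      have h3 := Nat.ceil_lt_add_one hi.le
      have h4 : (m i : ℝ) = ⌈c' i⌉₊ - 1 := by simp only [hm]; push_cast [Nat.cast_sub h1]; ring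
      constructor <;> linarith
    set f : Fin n → ℝ := fun i => c' i - m i with hf
    have hfz : ∀ i, f i = 0 → c' i = 0 := by
      intro i hi
      by_contra hne
      have := hmc i (lt_of_le_of_ne (hc'.1 i) (Ne.symm hne))
      simp only [hf] at hi
      linarith
    have hcf : ∀ i, c' i = 0 → f i = 0 := fun i hi => by simp [hf, hi, hmz i hi]
    have hf01 : ∀ i, 0 ≤ f i ∧ f i ≤ 1 := by
      intro i
      rcases (hc'.1 i).eq_or_lt with h | h
      · rw [hcf i h.symm]; norm_num
      · have := hmc i h
        simp only [hf]
        constructor <;> linarith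
    have hsum : ∑ i, f i = (t : ℝ) - ((∑ i, m i : ℕ) : ℝ) := by
      simp [hf, Finset.sum_sub_distrib, hc'.2.1]
    have hbox : f ∈ Box w := by
      refine ⟨hf01, good_of_zeros hcf g, ⟨t - ∑ i, m i, ?_⟩,
        fun j => x j - ∑ i, m i * w i j, fun j => ?_⟩
      · have : (0 : ℝ) ≤ (t : ℝ) - ((∑ i, m i : ℕ) : ℝ) := by
          rw [← hsum]; exact Finset.sum_nonneg fun i _ => (hf01 i).1
        have h2 : ∑ i, m i ≤ t := by
          have : ((∑ i, m i : ℕ) : ℝ) ≤ t := by linarith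
          exact_mod_cast this
        rw [hsum, Nat.cast_sub h2]
      · simp [hf, sub_mul, Finset.sum_sub_distrib, hc'.2.2 j]
    refine ⟨⟨⟨f, hbox⟩, m, fun i hi => hmz i (hfz i hi), ?_⟩, ?_⟩
    · rw [hsum]; push_cast; ring
    · apply Subtype.ext
      simp only
      funext j
      have h1 := (hX ⟨⟨f, hbox⟩, m, fun i hi => hmz i (hfz i hi), by rw [hsum]; push_cast; ring⟩).2.2 j
      simp only [hf, sub_add_cancel] at h1
      rw [hc'.2.2 j] at h1
      simp only at h1
      exact_mod_cast h1.symm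

lemma exists_poly {n d : ℕ} (w : Fin n → Fin d → ℤ) : ∃ p : Polynomial ℚ, p.natDegree ≤ d ∧
    ∀ t : ℕ, 0 < t →
      (Nat.card {x : Fin d → ℤ // ∃ c, IsRep w c t (fun i => (x i : ℝ))} : ℚ) = p.eval (t : ℚ) := by
  classical
  have := (box_finite w).fintype
  have hp : ∀ f : Box w, ∃ p : Polynomial ℚ, p.natDegree ≤ d ∧ ∀ t : ℕ, 0 < t →
      (Nat.card (Tr f.1 t) : ℚ) = p.eval (t : ℚ) := by
    rintro ⟨f, h1, g, ⟨h, hh⟩, x, hx⟩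
    have hle : h ≤ (Finset.univ.filter fun i => f i ≠ 0).card := by
      have : (h : ℝ) ≤ (Finset.univ.filter fun i => f i ≠ 0).card := by
        rw [← hh, ← Finset.sum_filter_ne_zero, Finset.card_eq_sum_ones]
        push_cast
        exact Finset.sum_le_sum fun i _ => (h1 i).2
      exact_mod_cast this
    obtain ⟨p, hp1, hp2⟩ := cnt_poly _ h hle
    refine ⟨p, hp1.trans ?_, fun t ht => ?_⟩
    · have := good_card g
      omega
    · rw [(card_tr f h hh t).2, hp2 t ht]
  choose p hp1 hp2 using hp
  refine ⟨∑ f, p f, Polynomial.natDegree_sum_le_of_forall_le _ _ fun f _ => hp1 f, fun t ht => ?_⟩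
  have : ∀ f : Box w, Finite (Tr f.1 t) := by
    rintro ⟨f, h1, g, ⟨h, hh⟩, x, hx⟩
    exact (card_tr f h hh t).1
  rw [count_eq, Nat.card_sigma, Polynomial.eval_finsetSum]
  push_cast
  exact Finset.sum_congr rfl fun f _ => hp2 f t ht

lemma mem_iff {n d : ℕ} (w : Fin n → Fin d → ℤ) (t : ℕ) (ht : 0 < t) (x : Fin d → ℝ) :
    x ∈ (t : ℝ) • convexHull ℝ (Set.range fun i => fun j => (w i j : ℝ)) ↔
      ∃ c, IsRep w c t x := by
  have ht' : (0 : ℝ) < t := by exact_mod_cast ht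
  rw [Set.mem_smul_set]
  constructor
  · rintro ⟨y, hy, rfl⟩
    rw [convexHull_range_eq_exists_affineCombination] at hy
    obtain ⟨s, a, h0, h1, hy⟩ := hy
    classical
    rw [Finset.affineCombination_eq_linear_combination _ _ _ h1] at hy
    refine ⟨fun i => t * (if i ∈ s then a i else 0), fun i => ?_, ?_, fun j => ?_⟩
    · dsimp only
      split_ifs with h
      · exact mul_nonneg ht'.le (h0 i h)
      · simp
    · rw [← Finset.mul_sum]
      simp [h1]
    · rw [← hy]
      simp [mul_assoc, ← Finset.mul_sum, ite_mul]
  · rintro ⟨c, h0, h1, h2⟩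
    refine ⟨(t : ℝ)⁻¹ • x, ?_, by rw [smul_inv_smul₀ ht'.ne']⟩
    refine mem_convexHull_of_exists_fintype (fun i => (t : ℝ)⁻¹ * c i)
      (fun i j => (w i j : ℝ)) (fun i => by have := h0 i; positivity) ?_ (fun i => ⟨i, rfl⟩) ?_
    · rw [← Finset.mul_sum, h1, inv_mul_cancel₀ ht'.ne']
    · funext j
      simp [mul_assoc, ← Finset.mul_sum, h2 j]

lemma count_finite {n d : ℕ} (w : Fin n → Fin d → ℤ) (t : ℕ) :
    Finite {x : Fin d → ℤ // ∃ c, IsRep w c t (fun i => (x i : ℝ))} := by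
  set B : Fin d → ℤ := fun j => ∑ i, t * |w i j| with hB
  refine ((Set.finite_Icc (-B) B).subset ?_).to_subtype
  rintro x ⟨c, h0, h1, h2⟩
  have hb : ∀ j, |x j| ≤ B j := by
    intro j
    have : |(x j : ℝ)| ≤ B j := by
      rw [show (x j : ℝ) = _ from (h2 j).symm]
      refine (Finset.abs_sum_le_sum_abs _ _).trans ?_
      simp only [hB]
      push_cast
      refine Finset.sum_le_sum fun i _ => ?_
      rw [abs_mul, abs_of_nonneg (h0 i)]
      refine mul_le_mul_of_nonneg_right ?_ (abs_nonneg _)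
      rw [← h1]
      exact Finset.single_le_sum (f := c) (fun i _ => h0 i) (Finset.mem_univ i)
    exact_mod_cast this
  exact ⟨fun j => (abs_le.1 (hb j)).1, fun j => (abs_le.1 (hb j)).2⟩

lemma lower {n d : ℕ} (w : Fin n → Fin d → ℤ)
    (hspan : affineSpan ℝ (Set.range fun i => fun j => (w i j : ℝ)) = ⊤) (t : ℕ) :
    (t + d).choose d ≤ Nat.card {x : Fin d → ℤ // ∃ c, IsRep w c t (fun i => (x i : ℝ))} := by
  classical
  obtain ⟨S, hS, hsp, hind⟩ := exists_affineIndependent ℝ (Fin d → ℝ)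
    (Set.range fun i => fun j => (w i j : ℝ))
  have hSfin : S.Finite := (Set.finite_range _).subset hS
  have := hSfin.fintype
  have hcard : Fintype.card S = d + 1 := by
    have := hind.affineSpan_eq_top_iff_card_eq_finrank_add_one.1
      (by rw [Subtype.range_coe, hsp, hspan])
    simpa using this
  choose b hb using fun y : S => hS y.2
  have hbinj : Function.Injective b := fun y z h => by
    apply Subtype.ext
    rw [← hb y, ← hb z, h]
  set T : Finset (Fin n) := Finset.univ.image b with hT
  have hTc : T.card = d + 1 := by
    rw [hT, Finset.card_image_of_injective _ hbinj, Finset.card_univ, hcard]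
  have hc : (T.piAntidiag t).card = (t + d).choose d := by
    rw [card_piAnti, hTc, Nat.multichoose_eq, show d + 1 + t - 1 = t + d by omega]
    exact Nat.choose_symm_add
  have hsum : ∀ m ∈ T.piAntidiag t, ∀ F : Fin n → ℝ,
      ∑ i, (m i : ℝ) * F i = ∑ y : S, (m (b y) : ℝ) * F (b y) := by
    intro m hm F
    rw [Finset.mem_piAntidiag] at hm
    rw [← Finset.sum_subset (Finset.subset_univ T), hT,
      Finset.sum_image (fun y _ z _ h => hbinj h)]
    intro i _ hi
    have : m i = 0 := by
      by_contra hne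
      exact hi (hm.2 i hne)
    simp [this]
  have := count_finite w t
  rw [← hc, ← Fintype.card_coe, ← Nat.card_eq_fintype_card]
  refine Nat.card_le_card_of_injective (fun m => ⟨fun j => ∑ i, m.1 i * w i j,
    fun i => (m.1 i : ℝ), fun i => by positivity, ?_, fun j => by simp⟩) ?_
  · have hm := (Finset.mem_piAntidiag.1 m.2)
    have h2 : ∑ i, m.1 i = t := by
      refine Eq.trans (Eq.symm ?_) hm.1
      apply Finset.sum_subset (Finset.subset_univ T)
      intro i _ hi
      by_contra hne
      exact hi (hm.2 i hne)
    dsimp only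
    exact_mod_cast h2
  · rintro ⟨m, hm⟩ ⟨m', hm'⟩ h
    simp only [Subtype.mk.injEq] at h ⊢
    have tot : ∀ m ∈ T.piAntidiag t, ∑ y : S, (m (b y) : ℝ) = t := by
      intro m hm
      have h1 := (Finset.mem_piAntidiag.1 hm).1
      rw [hT, Finset.sum_image (fun y _ z _ h => hbinj h)] at h1
      exact_mod_cast h1
    have hzero := (affineIndependent_iff.1 hind) Finset.univ
      (fun y => (m (b y) : ℝ) - m' (b y))
      (by rw [Finset.sum_sub_distrib, tot m hm, tot m' hm', sub_self])
      (by
        funext j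
        have e1 := hsum m hm (fun i => (w i j : ℝ))
        have e2 := hsum m' hm' (fun i => (w i j : ℝ))
        have e3 : ∑ i, (m i : ℝ) * (w i j : ℝ) = ∑ i, (m' i : ℝ) * (w i j : ℝ) := by
          exact_mod_cast congrFun h j
        have hbj : ∀ y : S, y.1 j = (w (b y) j : ℝ) := fun y => (congrFun (hb y) j).symm
        simp only [Finset.sum_apply, Pi.smul_apply, smul_eq_mul, sub_mul,
          Finset.sum_sub_distrib, Pi.zero_apply, hbj]
        rw [← e1, ← e2, e3, sub_self])
    funext i
    by_cases hi : i ∈ T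
    · obtain ⟨y, -, rfl⟩ := Finset.mem_image.1 hi
      have := hzero y (Finset.mem_univ y)
      have h3 : (m (b y) : ℝ) = m' (b y) := by linarith
      exact_mod_cast h3
    · have z1 : m i = 0 := by
        by_contra hne
        exact hi ((Finset.mem_piAntidiag.1 hm).2 i hne)
      have z2 : m' i = 0 := by
        by_contra hne
        exact hi ((Finset.mem_piAntidiag.1 hm').2 i hne)
      rw [z1, z2]

lemma degree_ge (p : Polynomial ℚ) (d : ℕ)
    (h : ∀ t : ℕ, 0 < t → (((t + d).choose d : ℕ) : ℚ) ≤ p.eval (t : ℚ)) :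
    (d : WithBot ℕ) ≤ p.degree := by
  by_contra hlt
  push Not at hlt
  have hlim := (Polynomial.div_tendsto_atTop_zero_of_degree_lt p (Polynomial.X ^ d)
    (by simpa using hlt)).comp (tendsto_natCast_atTop_atTop (R := ℚ))
  have hf : (0 : ℚ) < (d.factorial : ℚ) := by exact_mod_cast d.factorial_pos
  have hev := (hlim.eventually (gt_mem_nhds (inv_pos.2 hf))).and (Filter.eventually_gt_atTop 0)
  obtain ⟨t, h1, ht⟩ := hev.exists
  have ht' : (0 : ℚ) < t := by exact_mod_cast ht
  simp only [Function.comp, Polynomial.eval_pow, Polynomial.eval_X] at h1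
  rw [div_lt_iff₀ (by positivity)] at h1
  have h2 := h t ht
  have h3 := Nat.pow_le_choose (α := ℚ) d (t + d)
  rw [show t + d + 1 - d = t + 1 by omega] at h3
  have h4 : (t : ℚ) ^ d ≤ ((t + 1 : ℕ) : ℚ) ^ d := by gcongr; simp
  have h5 := h3
  rw [div_le_iff₀ hf] at h5
  rw [inv_mul_eq_div, lt_div_iff₀ hf] at h1
  nlinarith

end EhrhartAux

/-- **Ehrhart's theorem.** For a lattice `d`-polytope `P ⊂ ℝ^d` (the convex hull of finitely
many integer points, with full-dimensional affine span), there is a polynomial `p` of degree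
`d` with rational coefficients such that `#(tP ∩ ℤ^d) = p(t)` for all positive integers `t`. -/
theorem ehrhart_polynomial_exists (d : ℕ) (V : Finset (Fin d → ℤ)) (P : Set (Fin d → ℝ))
    (hP : P = convexHull ℝ ((fun v : Fin d → ℤ => fun i => (v i : ℝ)) '' (V : Set (Fin d → ℤ))))
    (hfull : affineSpan ℝ P = ⊤) :
    ∃ p : Polynomial ℚ, p.degree = (d : ℕ) ∧
      ∀ t : ℕ, 0 < t →
        (Nat.card {x : Fin d → ℤ // (fun i => (x i : ℝ)) ∈ (t : ℝ) • P} : ℚ)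
          = p.eval (t : ℚ) := by
  classical
  set w : Fin V.card → Fin d → ℤ := fun i => (V.equivFin.symm i).1 with hw
  have hrange : (fun v : Fin d → ℤ => fun i => (v i : ℝ)) '' (V : Set (Fin d → ℤ)) =
      Set.range fun i => fun j => (w i j : ℝ) := by
    ext y
    constructor
    · rintro ⟨v, hv, rfl⟩
      exact ⟨V.equivFin ⟨v, hv⟩, by simp [hw]⟩
    · rintro ⟨i, rfl⟩
      exact ⟨w i, (V.equivFin.symm i).2, rfl⟩
  rw [hrange] at hP
  have hspan : affineSpan ℝ (Set.range fun i => fun j => (w i j : ℝ)) = ⊤ := by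
    rw [hP, affineSpan_convexHull] at hfull
    exact hfull
  obtain ⟨p, hdeg, hp⟩ := EhrhartAux.exists_poly w
  refine ⟨p, le_antisymm (Polynomial.degree_le_of_natDegree_le hdeg)
    (EhrhartAux.degree_ge p d fun t ht => ?_), fun t ht => ?_⟩
  · rw [← hp t ht]
    exact_mod_cast EhrhartAux.lower w hspan t
  · rw [← hp t ht]
    congr 1
    refine Nat.card_congr (Equiv.subtypeEquivRight fun x => ?_)
    rw [hP]
    exact EhrhartAux.mem_iff w t ht _
end

section
/- Let P be a lattice d-polytope in ℝ^d and let p be the (unique) polynomial with p(t) = #(tP ∩ ℤ^d) for all positive integers t. Then for every positive integer t, p(−t) = (−1)^d · #(t P° ∩ ℤ^d), where P° denotes the topological interior of P; that is, the Ehrhart polynomial evaluated at negative integers counts, up to the sign (−1)^d, the interior lattice points of the dilates of P. -/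
open scoped Pointwise

namespace EhrRec

open Filter Topology

/-- Nonzero functionals are simultaneously nonzero on a dense set. -/
lemma dense_nonzero {E : Type} [NormedAddCommGroup E] [NormedSpace ℝ E] [FiniteDimensional ℝ E]
    {κ : Type} [Finite κ] (f : κ → E →ₗ[ℝ] ℝ) (hf : ∀ k, f k ≠ 0) :
    Dense {x : E | ∀ k, f k x ≠ 0} := by
  have : {x : E | ∀ k, f k x ≠ 0} = ⋂ k, {x : E | f k x ≠ 0} := by ext; simp
  rw [this]
  haveI : CompleteSpace E := FiniteDimensional.complete ℝ E
  apply dense_iInter_of_isOpen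
  · intro k
    exact isOpen_ne_fun (LinearMap.continuous_of_finiteDimensional (f k)) continuous_const
  · intro k
    have h1 : {x : E | f k x ≠ 0} = ((LinearMap.ker (f k) : Submodule ℝ E) : Set E)ᶜ := by
      ext; simp
    rw [h1, ← interior_eq_empty_iff_dense_compl]
    by_contra h
    have := Submodule.eq_top_of_nonempty_interior' (LinearMap.ker (f k))
      (Set.nonempty_iff_ne_empty.mpr h)
    exact hf k (LinearMap.ker_eq_top.mp this)

section LP

variable {ι E : Type} [Fintype ι] [AddCommGroup E] [Module ℝ E]

/-- Bases of `E` contained in the family `a`. -/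
def GS (a : ι → E) : Type :=
  {σ : Finset ι // LinearIndepOn ℝ a (σ : Set ι) ∧ Submodule.span ℝ (a '' (σ : Set ι)) = ⊤}

instance (a : ι → E) : Finite (GS a) := by
  classical
  unfold GS; infer_instance

noncomputable def B {a : ι → E} (σ : GS a) : Module.Basis σ.1 ℝ E :=
  Module.Basis.mk (v := fun i : σ.1 => a i) σ.2.1 (by
    have h := σ.2.2
    rw [Set.image_eq_range] at h
    exact h.ge)

lemma B_apply {a : ι → E} (σ : GS a) (i : σ.1) : B σ i = a i :=
  Module.Basis.mk_apply _ _ i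

lemma B_sum {a : ι → E} (σ : GS a) (x : E) : ∑ i : σ.1, (B σ).repr x i • a i = x := by
  conv_rhs => rw [← (B σ).sum_repr x]
  simp [B_apply]

lemma B_repr {a : ι → E} (σ : GS a) (l : ι → ℝ) (hl : ∀ i, i ∉ σ.1 → l i = 0) (i : σ.1) :
    (B σ).repr (∑ i, l i • a i) i = l i := by
  classical
  have h : ∑ i, l i • a i = ∑ i : σ.1, l i • B σ i := by
    simp_rw [B_apply]
    rw [Finset.sum_coe_sort σ.1 (fun i => l i • a i)]
    symm
    apply Finset.sum_subset (Finset.subset_univ _)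
    intro j _ hj
    rw [hl j hj, zero_smul]
  rw [h, (B σ).repr_sum_self]

/-- Reduction to linearly independent support without increasing cost. -/
lemma reduce (a : ι → E) (h : E →ₗ[ℝ] ℝ) (ha : ∀ i, h (a i) = 1) (w : ι → ℝ) (x : E) (n : ℕ) :
    ∀ l : ι → ℝ, (Finset.univ.filter (fun i => l i ≠ 0)).card ≤ n → (∀ i, 0 ≤ l i) →
      ∑ i, l i • a i = x →
      ∃ l' : ι → ℝ, (∀ i, 0 ≤ l' i) ∧ ∑ i, l' i • a i = x ∧ ∑ i, l' i * w i ≤ ∑ i, l i * w i ∧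
        LinearIndepOn ℝ a {i | l' i ≠ 0} := by
  classical
  induction n with
  | zero =>
    intro l hc hl hx
    refine ⟨l, hl, hx, le_rfl, ?_⟩
    have : {i | l i ≠ 0} = (∅ : Set ι) := by
      have := Finset.card_eq_zero.mp (Nat.le_zero.mp hc)
      ext i
      have h2 := Finset.ext_iff.mp this i
      simpa using h2
    rw [this]
    exact linearIndepOn_empty ℝ a
  | succ n ih =>
    intro l hc hl hx
    by_cases hli : LinearIndepOn ℝ a {i | l i ≠ 0}
    · exact ⟨l, hl, hx, le_rfl, hli⟩
    have hset : {i | l i ≠ 0} = ((Finset.univ.filter (fun i => l i ≠ 0) : Finset ι) : Set ι) := by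
      ext; simp
    rw [hset, not_linearIndepOn_finset_iff] at hli
    obtain ⟨f, hf0, j, hj, hfj⟩ := hli
    -- extend by zero
    obtain ⟨m, hm0, hmsupp, hmj, hmw⟩ : ∃ m : ι → ℝ, ∑ i, m i • a i = 0 ∧
        (∀ i, l i = 0 → m i = 0) ∧ m j ≠ 0 ∧ 0 ≤ ∑ i, m i * w i := by
      let m : ι → ℝ := fun i => if l i ≠ 0 then f i else 0
      have hm0 : ∑ i, m i • a i = 0 := by
        rw [← hf0, Finset.sum_filter]
        apply Finset.sum_congr rfl
        intro i _
        by_cases hi : l i = 0 <;> simp [m, hi]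
      have hms : ∀ i, l i = 0 → m i = 0 := by intro i hi; simp [m, hi]
      have hmj : m j ≠ 0 := by
        have : l j ≠ 0 := by simpa using hj
        simp [m, this, hfj]
      rcases le_total 0 (∑ i, m i * w i) with h1 | h1
      · exact ⟨m, hm0, hms, hmj, h1⟩
      · refine ⟨fun i => - m i, ?_, ?_, ?_, ?_⟩
        · simp [hm0]
        · intro i hi; simp [hms i hi]
        · simpa using hmj
        · simpa using h1
    have hsum : ∑ i, m i = 0 := by
      have := congrArg h hm0
      simpa [map_sum, ha] using this
    have hpos : ∃ i, 0 < m i := by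
      by_contra hcon
      push Not at hcon
      have := (Finset.sum_eq_zero_iff_of_nonpos (fun i _ => hcon i)).mp hsum j (Finset.mem_univ _)
      exact hmj this
    obtain ⟨i0, hi0, hmin⟩ := Finset.exists_min_image (Finset.univ.filter (fun i => 0 < m i))
      (fun i => l i / m i) (by
        obtain ⟨i, hi⟩ := hpos
        exact ⟨i, by simpa using hi⟩)
    have hi0 : 0 < m i0 := by simpa using hi0
    set θ := l i0 / m i0 with hθ
    have hθ0 : 0 ≤ θ := div_nonneg (hl _) hi0.le
    have hl0 : l i0 ≠ 0 := fun h0 => hi0.ne' (hmsupp _ h0)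
    have key := ih (fun i => l i - θ * m i) ?_ ?_ ?_
    · obtain ⟨l', h1, h2, h3, h4⟩ := key
      refine ⟨l', h1, h2, h3.trans ?_, h4⟩
      simp_rw [sub_mul, mul_assoc]
      rw [Finset.sum_sub_distrib, ← Finset.mul_sum]
      have := mul_nonneg hθ0 hmw
      linarith
    · have hss : (Finset.univ.filter (fun i => l i - θ * m i ≠ 0)) ⊂
          (Finset.univ.filter (fun i => l i ≠ 0)) := by
        rw [Finset.ssubset_iff_of_subset]
        · refine ⟨i0, by simpa using hl0, ?_⟩
          simp [hθ, div_mul_cancel₀ _ hi0.ne']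
        · intro i
          simp only [Finset.mem_filter, Finset.mem_univ, true_and]
          intro h1 h2
          apply h1
          simp [h2, hmsupp i h2]
      have := Finset.card_lt_card hss
      omega
    · intro i
      by_cases hi : 0 < m i
      · have := hmin i (by simpa using hi)
        have h2 := (le_div_iff₀ hi).mp this
        simpa using h2
      · have := mul_nonneg hθ0 (neg_nonneg.mpr (not_lt.mp hi))
        have := hl i
        linarith
    · simp_rw [sub_smul, mul_smul]
      rw [Finset.sum_sub_distrib, ← Finset.smul_sum, hm0, hx]
      simp

/-- A cone point with a cost bound lies in a basis cone of at most that cost. -/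
lemma to_basis (a : ι → E) (hspan : Submodule.span ℝ (Set.range a) = ⊤)
    (h : E →ₗ[ℝ] ℝ) (ha : ∀ i, h (a i) = 1) (w : ι → ℝ) (x : E)
    (hgen : ∀ (σ : GS a) (i : σ.1), (B σ).repr x i ≠ 0)
    (l : ι → ℝ) (hl : ∀ i, 0 ≤ l i) (hx : ∑ i, l i • a i = x) :
    ∃ σ : GS a, (∀ i, 0 < (B σ).repr x i) ∧
      ∑ i, (B σ).repr x i * w i ≤ ∑ i, l i * w i := by
  classical
  obtain ⟨l', h1, h2, h3, h4⟩ := reduce a h ha w x _ l le_rfl hl hx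
  obtain ⟨b, -, hsb, hb, hbi⟩ := exists_linearIndepOn_extension h4 (Set.subset_univ _)
  let σ : GS a := ⟨b.toFinite.toFinset, by simpa using hbi, by
    rw [Set.Finite.coe_toFinset, eq_top_iff, ← hspan, Submodule.span_le]
    simpa using hb⟩
  have hoff : ∀ i, i ∉ σ.1 → l' i = 0 := by
    intro i hi
    by_contra hne
    exact hi (by simpa [σ] using hsb hne)
  have hr : ∀ i : σ.1, (B σ).repr x i = l' i := by
    intro i
    rw [← h2]
    exact B_repr σ l' hoff i
  refine ⟨σ, fun i => lt_of_le_of_ne ?_ (hgen σ i).symm, ?_⟩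
  · rw [hr]; exact h1 _
  · refine le_trans (le_of_eq ?_) h3
    simp_rw [hr]
    rw [Finset.sum_coe_sort σ.1 (fun i => l' i * w i)]
    apply Finset.sum_subset (Finset.subset_univ _)
    intro j _ hj
    rw [hoff j hj, zero_mul]

lemma lp (a : ι → E) (hspan : Submodule.span ℝ (Set.range a) = ⊤)
    (h : E →ₗ[ℝ] ℝ) (ha : ∀ i, h (a i) = 1) :
    ∃ T : Set (GS a), ∀ x : E, (∀ (σ : GS a) (i : σ.1), (B σ).repr x i ≠ 0) →
      (∀ σ ∈ T, ∀ τ ∈ T, (∀ i, 0 < (B σ).repr x i) → (∀ i, 0 < (B τ).repr x i) → σ = τ) ∧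
      ((∃ l : ι → ℝ, (∀ i, 0 ≤ l i) ∧ ∑ i, l i • a i = x) ↔
        ∃ σ ∈ T, ∀ i, 0 < (B σ).repr x i) := by
  classical
  -- generic cost
  have hdense := dense_nonzero (E := ι → ℝ)
    (κ := Σ σ : GS a, {j : ι // j ∉ σ.1})
    (fun k => LinearMap.proj k.2.1 - ∑ i : k.1.1, (B k.1).repr (a k.2.1) i • LinearMap.proj i.1) (by
      rintro ⟨σ, j, hj⟩ h0
      have := LinearMap.congr_fun h0 (Pi.single j 1)
      simp only [LinearMap.sub_apply, LinearMap.proj_apply, Pi.single_eq_same, LinearMap.sum_apply,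
        LinearMap.smul_apply, LinearMap.zero_apply] at this
      rw [Finset.sum_eq_zero] at this
      · simp at this
      · intro i _
        have : i.1 ≠ j := fun hh => hj (hh ▸ i.2)
        simp [this])
  obtain ⟨w, hw⟩ := hdense.nonempty
  let y : ∀ σ : GS a, E →ₗ[ℝ] ℝ := fun σ => (B σ).constr ℝ (fun i : σ.1 => w i)
  have hy : ∀ (σ : GS a) x, y σ x = ∑ i, (B σ).repr x i * w i := by
    intro σ x
    simp [y, Module.Basis.constr_apply_fintype]
  have hya : ∀ (σ : GS a) (i : ι), i ∈ σ.1 → y σ (a i) = w i := by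
    intro σ i hi
    have := (B σ).constr_basis ℝ (fun i : σ.1 => w i) ⟨i, hi⟩
    rw [B_apply] at this
    exact this
  have hwn : ∀ (σ : GS a) (j : ι), j ∉ σ.1 → w j ≠ y σ (a j) := by
    intro σ j hj heq
    apply hw ⟨σ, j, hj⟩
    simp [heq, hy]
  refine ⟨{σ | ∀ j, j ∉ σ.1 → y σ (a j) < w j}, fun x hgen => ⟨?_, ?_, ?_⟩⟩
  · have main : ∀ σ τ : GS a, (∀ j, j ∉ τ.1 → y τ (a j) < w j) →
        (∀ i, 0 < (B σ).repr x i) → σ ≠ τ → y τ x < y σ x := by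
      intro σ τ hτ hσx hne
      have hcard : σ.1.card = τ.1.card := by
        have h1 := Module.finrank_eq_card_basis (B σ)
        have h2 := Module.finrank_eq_card_basis (B τ)
        simp only [Fintype.card_coe] at h1 h2
        omega
      have hex : ∃ i ∈ σ.1, i ∉ τ.1 := by
        by_contra hcon
        push Not at hcon
        exact hne (Subtype.ext (Finset.eq_of_subset_of_card_le hcon hcard.ge))
      obtain ⟨i0, hi0, hi0'⟩ := hex
      have e1 : y τ x = ∑ i : σ.1, (B σ).repr x i * y τ (a i) := by
        conv_lhs => rw [← B_sum σ x]
        simp [map_sum]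
      rw [e1, hy]
      apply Finset.sum_lt_sum
      · intro i _
        apply mul_le_mul_of_nonneg_left _ (hσx i).le
        by_cases hi : i.1 ∈ τ.1
        · exact (hya τ i hi).le
        · exact (hτ i hi).le
      · exact ⟨⟨i0, hi0⟩, Finset.mem_univ _, mul_lt_mul_of_pos_left (hτ i0 hi0') (hσx _)⟩
    intro σ hσ τ hτ hσx hτx
    by_contra hne
    have := main σ τ hτ hσx hne
    have := main τ σ hσ hτx (Ne.symm hne)
    linarith
  · rintro ⟨l, hl, hx⟩
    haveI := Fintype.ofFinite (GS a)
    obtain ⟨σ0, hσ0, -⟩ := to_basis a hspan h ha w x hgen l hl hx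
    obtain ⟨σ, hσ, hmin⟩ := Finset.exists_min_image
      (Finset.univ.filter (fun σ : GS a => ∀ i, 0 < (B σ).repr x i)) (fun σ => y σ x)
      ⟨σ0, by simpa using hσ0⟩
    have hσ : ∀ i, 0 < (B σ).repr x i := by simpa using hσ
    refine ⟨σ, ?_, hσ⟩
    intro j hj
    by_contra hcon
    have hlt : w j < y σ (a j) := lt_of_le_of_ne (not_lt.mp hcon) (hwn σ j hj)
    -- small step
    have hev : ∀ᶠ ε : ℝ in 𝓝[>] 0, ∀ i : σ.1,
        0 < (B σ).repr x i - ε * (B σ).repr (a j) i := by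
      rw [eventually_all]
      intro i
      apply Filter.Eventually.filter_mono nhdsWithin_le_nhds
      have hc : Continuous (fun ε : ℝ => (B σ).repr x i - ε * (B σ).repr (a j) i) := by fun_prop
      apply (hc.tendsto 0).eventually_const_lt
      simpa using hσ i
    obtain ⟨ε, hε, hεpos⟩ := (hev.and self_mem_nhdsWithin).exists
    have hεpos : 0 < ε := hεpos
    let l2 : ι → ℝ := fun i => if hi : i ∈ σ.1 then
      (B σ).repr x ⟨i, hi⟩ - ε * (B σ).repr (a j) ⟨i, hi⟩ else if i = j then ε else 0
    have hsplit : ∀ (F : Type) [AddCommGroup F] [Module ℝ F] (g : ι → F), ∑ i, l2 i • g i =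
        ∑ i : σ.1, ((B σ).repr x i - ε * (B σ).repr (a j) i) • g i + ε • g j := by
      intro F _ _ g
      rw [← Finset.sum_add_sum_compl σ.1]
      congr 1
      · rw [← Finset.sum_coe_sort σ.1]
        apply Finset.sum_congr rfl
        intro i _
        simp [l2]
      · rw [Finset.sum_eq_single j]
        · simp [l2, hj]
        · intro i hi hij
          simp [l2, Finset.mem_compl.mp hi, hij]
        · intro hh; exact absurd (Finset.mem_compl.mpr hj) hh
    have hl2 : ∀ i, 0 ≤ l2 i := by
      intro i
      by_cases hi : i ∈ σ.1
      · simp only [l2, hi, dite_true]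
        exact (hε ⟨i, hi⟩).le
      · by_cases hij : i = j
        · subst hij; simp [l2, hi, hεpos.le]
        · simp [l2, hi, hij]
    have hx2 : ∑ i, l2 i • a i = x := by
      rw [hsplit E a]
      simp_rw [sub_smul, mul_smul]
      rw [Finset.sum_sub_distrib, ← Finset.smul_sum, B_sum, B_sum]
      abel
    obtain ⟨τ, hτ, hτc⟩ := to_basis a hspan h ha w x hgen l2 hl2 hx2
    have hle := hmin τ (by simpa using hτ)
    have hc2 := hsplit ℝ w
    simp only [smul_eq_mul] at hc2
    rw [hc2] at hτc
    simp_rw [sub_mul, mul_assoc] at hτc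
    rw [Finset.sum_sub_distrib, ← Finset.mul_sum, ← hy, ← hy, ← hy] at hτc
    have := mul_pos hεpos (sub_pos.mpr hlt)
    linarith
  · rintro ⟨σ, -, hσ⟩
    refine ⟨fun i => if hi : i ∈ σ.1 then (B σ).repr x ⟨i, hi⟩ else 0, ?_, ?_⟩
    · intro i
      dsimp only
      split_ifs with hi
      · exact (hσ _).le
      · exact le_rfl
    · conv_rhs => rw [← B_sum σ x]
      rw [← Finset.sum_add_sum_compl σ.1]
      rw [Finset.sum_eq_zero (s := σ.1ᶜ), add_zero]
      · rw [← Finset.sum_coe_sort σ.1]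
        apply Finset.sum_congr rfl
        intro i _
        simp
      · intro i hi
        simp [Finset.mem_compl.mp hi]

end LP

section Count

open Polynomial

/-- half-open ray -/
def J (s : Bool) : Set ℝ := if s then Set.Ici 0 else Set.Ioi 0
/-- half-open unit interval -/
def I (s : Bool) : Set ℝ := if s then Set.Ico 0 1 else Set.Ioc 0 1

lemma I_sub (s : Bool) {c : ℝ} (h : c ∈ I s) : 0 ≤ c ∧ c ≤ 1 := by
  cases s <;> simp [I] at h <;> constructor <;> linarith

lemma I_flip (s : Bool) {c : ℝ} : 1 - c ∈ I (!s) ↔ c ∈ I s := by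
  cases s <;> simp [I] <;> constructor <;> rintro ⟨h1, h2⟩ <;> constructor <;> linarith

lemma J_exists (s : Bool) {c : ℝ} (h : c ∈ J s) : ∃ n : ℕ, c - n ∈ I s := by
  cases s
  · simp only [J, Bool.false_eq_true, if_false, Set.mem_Ioi] at h
    refine ⟨⌈c⌉₊ - 1, ?_⟩
    have h1 : 1 ≤ ⌈c⌉₊ := Nat.one_le_ceil_iff.mpr h
    have h2 := Nat.ceil_lt_add_one h.le
    have h3 := Nat.le_ceil c
    simp only [I, Bool.false_eq_true, if_false, Set.mem_Ioc]
    push_cast [Nat.cast_sub h1]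
    constructor <;> linarith
  · simp only [J, if_true, Set.mem_Ici] at h
    refine ⟨⌊c⌋₊, ?_⟩
    have h2 := Nat.floor_le h
    have h3 := Nat.lt_floor_add_one c
    simp only [I, if_true, Set.mem_Ico]
    constructor <;> linarith

lemma J_add (s : Bool) {c : ℝ} (h : c ∈ I s) (n : ℕ) : c + n ∈ J s := by
  have : (0:ℝ) ≤ n := n.cast_nonneg
  cases s <;> simp [I, J] at h ⊢ <;> linarith

lemma I_unique (s : Bool) {c : ℝ} {n m : ℕ} (hn : c - n ∈ I s) (hm : c - m ∈ I s) : n = m := by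
  have h1 : (n : ℝ) < m + 1 := by cases s <;> simp [I] at hn hm <;> linarith
  have h2 : (m : ℝ) < n + 1 := by cases s <;> simp [I] at hn hm <;> linarith
  have h1 : n < m + 1 := by exact_mod_cast h1
  have h2 : m < n + 1 := by exact_mod_cast h2
  omega

/-- shifted binomial polynomial `choose (X - k + d) d`. -/
noncomputable def bp (d : ℕ) (k : ℤ) : ℚ[X] :=
  C ((d.factorial : ℚ)⁻¹) * ∏ j ∈ Finset.range d, (X - C (k : ℚ) + C ((j : ℚ) + 1))

lemma bp_eval (d : ℕ) (k : ℤ) (x : ℚ) :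
    (bp d k).eval x = (d.factorial : ℚ)⁻¹ * ∏ j ∈ Finset.range d, (x - k + (j + 1)) := by
  simp [bp, eval_prod]

lemma bp_recip (d : ℕ) (k : ℤ) (t : ℚ) :
    (bp d k).eval (-t) = (-1) ^ d * (bp d (d + 1 - k)).eval t := by
  rw [bp_eval, bp_eval, ← Finset.prod_range_reflect]
  have : ∀ j ∈ Finset.range d, (-t - (k:ℚ) + (((d - 1 - j : ℕ) : ℚ) + 1)) =
      (-1) * (t - ((d + 1 - k : ℤ) : ℚ) + (j + 1)) := by
    intro j hj
    have hj := Finset.mem_range.mp hj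
    have : ((d - 1 - j : ℕ) : ℚ) = d - 1 - j := by
      rw [Nat.cast_sub (by omega), Nat.cast_sub (by omega)]; simp
    rw [this]
    push_cast
    ring
  rw [Finset.prod_congr rfl this, Finset.prod_mul_distrib]
  simp
  ring

lemma bp_nat (d n : ℕ) (k : ℤ) : (bp d k).eval ((k + n : ℤ) : ℚ) = ((n + d).choose d : ℚ) := by
  rw [bp_eval]
  have h1 : ∏ j ∈ Finset.range d, (((k + n : ℤ) : ℚ) - k + (j + 1)) =
      ((n + 1).ascFactorial d : ℚ) := by
    rw [Nat.ascFactorial_eq_prod_range]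
    push_cast
    apply Finset.prod_congr rfl
    intro j _
    ring
  rw [h1, Nat.ascFactorial_eq_factorial_mul_choose]
  push_cast
  have : (d.factorial : ℚ) ≠ 0 := by positivity
  field_simp
  try congr 1

lemma bp_zero (d : ℕ) (k t : ℤ) (h1 : t < k) (h2 : k ≤ t + d) : (bp d k).eval (t : ℚ) = 0 := by
  rw [bp_eval]
  apply mul_eq_zero_of_right
  apply Finset.prod_eq_zero (i := (k - t - 1).toNat)
  · rw [Finset.mem_range]; omega
  · have : (((k - t - 1).toNat : ℕ) : ℚ) = ((k - t - 1 : ℤ) : ℚ) := by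
      rw [← Int.cast_natCast, Int.toNat_of_nonneg (by omega)]
    rw [this]; push_cast; ring

lemma card_sum {κ : Type} [Fintype κ] (d k : ℕ) (hκ : Fintype.card κ = d + 1) :
    Finite {n : κ → ℕ // ∑ i, n i = k} ∧
    Nat.card {n : κ → ℕ // ∑ i, n i = k} = (k + d).choose d := by
  classical
  have e' : {n : κ → ℕ // ∑ i, n i = k} ≃ Sym κ k := (Sym.equivNatSumOfFintype κ k).symm
  refine ⟨Finite.of_equiv _ e'.symm, ?_⟩
  rw [Nat.card_congr e', Nat.card_eq_fintype_card, Sym.card_sym_eq_choose, hκ]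
  rw [show d + 1 + k - 1 = k + d by omega]
  rw [← Nat.choose_symm_add]

lemma card_sum_shift {κ : Type} [Fintype κ] (d : ℕ) (hκ : Fintype.card κ = d + 1)
    (k : ℤ) (hk : k ≤ d + 1) (t : ℕ) (ht : 0 < t) :
    Finite {n : κ → ℕ // (∑ i, n i : ℤ) + k = t} ∧
    (Nat.card {n : κ → ℕ // (∑ i, n i : ℤ) + k = t} : ℚ) = (bp d k).eval (t : ℚ) := by
  rcases lt_or_ge (t : ℤ) k with h | h
  · have : IsEmpty {n : κ → ℕ // (∑ i, n i : ℤ) + k = t} := by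
      refine ⟨fun ⟨n, hn⟩ => ?_⟩
      have : (0 : ℤ) ≤ ∑ i, (n i : ℤ) := Finset.sum_nonneg (fun i _ => by positivity)
      omega
    refine ⟨inferInstance, ?_⟩
    rw [Nat.card_of_isEmpty]
    have := bp_zero d k t h (by omega)
    simp only [Int.cast_natCast] at this
    rw [this]; simp
  · obtain ⟨m, hm⟩ := Int.eq_ofNat_of_zero_le (sub_nonneg.mpr h)
    have hiff : ∀ n : κ → ℕ, ((∑ i, n i : ℤ) + k = t) ↔ ∑ i, n i = m := by
      intro n
      rw [← @Nat.cast_inj ℤ]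
      push_cast
      omega
    have e : {n : κ → ℕ // (∑ i, n i : ℤ) + k = t} ≃ {n : κ → ℕ // ∑ i, n i = m} :=
      Equiv.subtypeEquivRight hiff
    obtain ⟨h1, h2⟩ := card_sum (κ := κ) d m hκ
    refine ⟨Finite.of_equiv _ e.symm, ?_⟩
    rw [Nat.card_congr e, h2, ← bp_nat d m k, show k + (m : ℤ) = t by omega]
    simp

/-- Reciprocity for half-open simplicial cones. -/
lemma simplicial {κ L : Type} [Fintype κ] [AddCommGroup L] (d : ℕ) (hκ : Fintype.card κ = d + 1)
    (c : L →+ (κ → ℝ)) (a : κ → L) (hca : ∀ n : κ → ℕ, ∀ i, c (∑ j, n j • a j) i = n i)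
    (h : L →+ ℤ) (hh : ∀ x, (h x : ℝ) = ∑ i, c x i)
    (hfin : {x : L | ∀ i, 0 ≤ c x i ∧ c x i ≤ 1}.Finite) (s : κ → Bool) :
    ∃ q : ℚ[X], ∀ t : ℕ, 0 < t →
      Finite {x : L // (∀ i, c x i ∈ J (s i)) ∧ h x = t} ∧
      q.eval (t : ℚ) = Nat.card {x : L // (∀ i, c x i ∈ J (s i)) ∧ h x = t} ∧
      Finite {x : L // (∀ i, c x i ∈ J (!(s i))) ∧ h x = t} ∧
      q.eval (-(t : ℚ)) = (-1) ^ d * Nat.card {x : L // (∀ i, c x i ∈ J (!(s i))) ∧ h x = t} := by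
  classical
  have hha : ∀ n : κ → ℕ, h (∑ j, n j • a j) = ∑ j, (n j : ℤ) := by
    intro n
    have := hh (∑ j, n j • a j)
    simp_rw [hca] at this
    exact_mod_cast this
  let Box : (κ → Bool) → Type := fun s => {x : L // ∀ i, c x i ∈ I (s i)}
  have hBfin : ∀ s, Finite (Box s) := by
    intro s
    exact (hfin.subset (t := {x | ∀ i, c x i ∈ I (s i)}) (fun x hx i => I_sub (s i) (hx i))).to_subtype
  haveI : ∀ s, Fintype (Box s) := fun s => Fintype.ofFinite _
  have hBle : ∀ s (b : Box s), h b.1 ≤ d + 1 := by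
    intro s b
    have h1 : ∑ i, c b.1 i ≤ ∑ _i : κ, (1 : ℝ) := Finset.sum_le_sum (fun i _ => (I_sub _ (b.2 i)).2)
    rw [← hh] at h1
    simp [hκ] at h1
    exact_mod_cast h1
  have hone : ∀ i, c (∑ j, a j) i = 1 := by
    intro i
    have := hca (fun _ => 1) i
    simpa using this
  have hhone : h (∑ j, a j) = d + 1 := by
    have := hha (fun _ => 1)
    simpa [hκ] using this
  -- counting
  have count : ∀ s, ∀ t : ℕ, 0 < t → Finite {x : L // (∀ i, c x i ∈ J (s i)) ∧ h x = t} ∧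
      (Nat.card {x : L // (∀ i, c x i ∈ J (s i)) ∧ h x = t} : ℚ) =
        ∑ b : Box s, (bp d (h b.1)).eval (t : ℚ) := by
    intro s t ht
    let S := Σ b : Box s, {n : κ → ℕ // (∑ i, n i : ℤ) + h b.1 = t}
    have hf : ∀ b : Box s, Finite {n : κ → ℕ // (∑ i, n i : ℤ) + h b.1 = t} :=
      fun b => (card_sum_shift d hκ (h b.1) (hBle s b) t ht).1
    let φ : S → {x : L // (∀ i, c x i ∈ J (s i)) ∧ h x = t} := fun p =>
      ⟨p.1.1 + ∑ j, p.2.1 j • a j, by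
        intro i
        rw [map_add, Pi.add_apply, hca]
        exact J_add _ (p.1.2 i) _, by
        rw [map_add, hha, add_comm]; exact p.2.2⟩
    have hφ : Function.Bijective φ := by
      constructor
      · rintro ⟨⟨b, hb⟩, n, hn⟩ ⟨⟨b', hb'⟩, n', hn'⟩ heq
        have heq : b + ∑ j, n j • a j = b' + ∑ j, n' j • a j := congrArg Subtype.val heq
        have hnn : n = n' := by
          funext i
          have h1 : c (b + ∑ j, n j • a j) i - n i ∈ I (s i) := by
            rw [map_add, Pi.add_apply, hca]; simpa using hb i
          have h2 : c (b + ∑ j, n j • a j) i - n' i ∈ I (s i) := by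
            rw [heq, map_add, Pi.add_apply, hca]; simpa using hb' i
          exact I_unique _ h1 h2
        subst hnn
        have := add_right_cancel heq
        subst this
        rfl
      · rintro ⟨x, hx, hxt⟩
        choose n hn using fun i => J_exists (s i) (hx i)
        refine ⟨⟨⟨x - ∑ j, n j • a j, ?_⟩, n, ?_⟩, ?_⟩
        · intro i
          rw [map_sub, Pi.sub_apply, hca]; exact hn i
        · simp only
          rw [map_sub, hha, hxt]; ring
        · apply Subtype.ext
          simp [φ]
    have e := Equiv.ofBijective φ hφ
    haveI : Finite S := inferInstance
    refine ⟨Finite.of_equiv _ e, ?_⟩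
    rw [← Nat.card_congr e, Nat.card_sigma]
    push_cast
    apply Finset.sum_congr rfl
    intro b _
    exact (card_sum_shift d hκ (h b.1) (hBle s b) t ht).2
  refine ⟨∑ b : Box s, bp d (h b.1), fun t ht => ?_⟩
  obtain ⟨f1, c1⟩ := count s t ht
  obtain ⟨f2, c2⟩ := count (fun i => !(s i)) t ht
  refine ⟨f1, ?_, f2, ?_⟩
  · rw [c1, eval_finsetSum]
  · rw [c2, eval_finsetSum, Finset.mul_sum]
    let ψ : Box s ≃ Box (fun i => !(s i)) :=
      { toFun := fun b => ⟨∑ j, a j - b.1, fun i => by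
          rw [map_sub, Pi.sub_apply, hone]; exact (I_flip _).mpr (b.2 i)⟩
        invFun := fun b => ⟨∑ j, a j - b.1, fun i => by
          rw [map_sub, Pi.sub_apply, hone]
          have := (I_flip (!(s i))).mpr (b.2 i)
          simpa using this⟩
        left_inv := fun b => by simp
        right_inv := fun b => by simp }
    apply Fintype.sum_equiv ψ
    intro b
    rw [bp_recip]
    simp only [ψ, Equiv.coe_fn_mk, map_sub, hhone]

end Count

section Perturb

lemma coord_ev (c c' : ℝ) (hc' : c' ≠ 0) :
    ∀ᶠ ε : ℝ in 𝓝[>] 0, (c + ε * c' ≠ 0) ∧ (0 < c + ε * c' ↔ c ∈ J (decide (0 < c'))) := by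
  have hcont : Continuous (fun ε : ℝ => c + ε * c') := by fun_prop
  have htend : Tendsto (fun ε : ℝ => c + ε * c') (𝓝[>] 0) (𝓝 c) := by
    have := (hcont.tendsto 0).mono_left (nhdsWithin_le_nhds (s := Set.Ioi 0))
    simpa using this
  have hJ : ∀ s, 0 < c → c ∈ J s := by
    intro s hc; cases s <;> simp [J] <;> linarith
  have hJ' : ∀ s, c < 0 → c ∉ J s := by
    intro s hc; cases s <;> simp [J] <;> linarith
  rcases lt_trichotomy c 0 with hc | hc | hc
  · filter_upwards [htend.eventually_lt_const hc] with ε hε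
    refine ⟨hε.ne, ?_⟩
    have := hJ' (decide (0 < c')) hc
    constructor
    · intro h; linarith
    · intro h; exact absurd h this
  · subst hc
    filter_upwards [self_mem_nhdsWithin] with ε hε
    have hε : 0 < ε := hε
    refine ⟨by simp [hε.ne', hc'], ?_⟩
    by_cases h : 0 < c'
    · simp [J, h, hε]
    · simp [J, h, hε]
  · filter_upwards [htend.eventually_const_lt hc] with ε hε
    exact ⟨hε.ne', fun _ => hJ _ hc, fun _ => hε⟩

lemma core {ι E : Type} [Fintype ι] [AddCommGroup E] [Module ℝ E] (a : ι → E) (T : Set (GS a))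
    (hT : ∀ x : E, (∀ (σ : GS a) (i : σ.1), (B σ).repr x i ≠ 0) →
      (∀ σ ∈ T, ∀ τ ∈ T, (∀ i, 0 < (B σ).repr x i) → (∀ i, 0 < (B τ).repr x i) → σ = τ) ∧
      ((∃ l : ι → ℝ, (∀ i, 0 ≤ l i) ∧ ∑ i, l i • a i = x) ↔
        ∃ σ ∈ T, ∀ i, 0 < (B σ).repr x i))
    (x η : E) (hη : ∀ (σ : GS a) (i : σ.1), (B σ).repr η i ≠ 0) (q : Prop)
    (hq : ∀ᶠ ε : ℝ in 𝓝[>] 0,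
      ((∃ l : ι → ℝ, (∀ i, 0 ≤ l i) ∧ ∑ i, l i • a i = x + ε • η) ↔ q)) :
    (q ↔ ∃ σ ∈ T, ∀ i, (B σ).repr x i ∈ J (decide (0 < (B σ).repr η i))) ∧
    (∀ σ ∈ T, ∀ τ ∈ T, (∀ i, (B σ).repr x i ∈ J (decide (0 < (B σ).repr η i))) →
      (∀ i, (B τ).repr x i ∈ J (decide (0 < (B τ).repr η i))) → σ = τ) := by
  have hev : ∀ᶠ ε : ℝ in 𝓝[>] 0, ∀ (σ : GS a) (i : σ.1),
      ((B σ).repr x i + ε * (B σ).repr η i ≠ 0) ∧ (0 < (B σ).repr x i + ε * (B σ).repr η i ↔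
        (B σ).repr x i ∈ J (decide (0 < (B σ).repr η i))) := by
    rw [eventually_all]
    intro σ
    rw [eventually_all]
    intro i
    exact coord_ev _ _ (hη σ i)
  obtain ⟨ε, h1, h2⟩ := (hev.and hq).exists
  have hr : ∀ (σ : GS a) (i : σ.1), (B σ).repr (x + ε • η) i =
      (B σ).repr x i + ε * (B σ).repr η i := by
    intro σ i; simp
  have h3 := hT (x + ε • η) (fun σ i => by rw [hr]; exact (h1 σ i).1)
  have h4 : ∀ σ : GS a, (∀ i, 0 < (B σ).repr (x + ε • η) i) ↔
      (∀ i, (B σ).repr x i ∈ J (decide (0 < (B σ).repr η i))) := by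
    intro σ
    apply forall_congr'
    intro i
    rw [hr]; exact (h1 σ i).2
  simp_rw [h4] at h3
  exact ⟨h2.symm.trans h3.2, h3.1⟩

lemma card_partition {Z K : Type} [Fintype K] (q : Z → Prop) (S : K → Z → Prop)
    (h1 : ∀ z, q z ↔ ∃ k, S k z) (h2 : ∀ z k k', S k z → S k' z → k = k')
    (hf : ∀ k, Finite {z // S k z}) :
    Nat.card {z // q z} = ∑ k, Nat.card {z // S k z} := by
  rw [← Nat.card_sigma]
  symm
  apply Nat.card_congr
  refine Equiv.ofBijective (fun p : (Σ k, {z // S k z}) => ⟨p.2.1, (h1 _).mpr ⟨p.1, p.2.2⟩⟩) ⟨?_, ?_⟩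
  · rintro ⟨k, z, hz⟩ ⟨k', z', hz'⟩ heq
    have heq : z = z' := congrArg Subtype.val heq
    subst heq
    have := h2 z k k' hz hz'
    subst this
    rfl
  · rintro ⟨z, hz⟩
    obtain ⟨k, hk⟩ := (h1 z).mp hz
    exact ⟨⟨k, z, hk⟩, rfl⟩

lemma ev_plus {W : Type} [NormedAddCommGroup W] [NormedSpace ℝ W] (P : Set W) (hc : Convex ℝ P)
    (hcl : IsClosed P) (ξ : W) (hξ : ξ ∈ interior P) (z : W) (t : ℝ) (ht : 0 < t) :
    ∀ᶠ ε : ℝ in 𝓝[>] 0, ((t + ε)⁻¹ • (z + ε • ξ) ∈ P ↔ z ∈ t • P) := by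
  rw [Set.mem_smul_set_iff_inv_smul_mem₀ ht.ne']
  by_cases h : t⁻¹ • z ∈ P
  · filter_upwards [self_mem_nhdsWithin] with ε hε
    have hε : 0 < ε := hε
    refine ⟨fun _ => h, fun _ => ?_⟩
    have := hc h (interior_subset hξ) (a := t / (t + ε)) (b := ε / (t + ε)) (by positivity)
      (by positivity) (by field_simp)
    convert this using 1
    rw [smul_add, smul_smul, smul_smul]
    congr 2
    · field_simp
    · field_simp
  · have hcont : ContinuousAt (fun ε : ℝ => (t + ε)⁻¹ • (z + ε • ξ)) 0 := by
      apply ContinuousAt.smul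
      · apply ContinuousAt.inv₀ (by fun_prop)
        simpa using ht.ne'
      · fun_prop
    have hev := hcont.eventually_mem (s := Pᶜ) (by
      apply hcl.isOpen_compl.mem_nhds
      simpa using h)
    filter_upwards [hev.filter_mono nhdsWithin_le_nhds] with ε hε
    exact ⟨fun h' => absurd h' hε, fun h' => absurd h' h⟩

lemma ev_minus {W : Type} [NormedAddCommGroup W] [NormedSpace ℝ W] (P : Set W) (hc : Convex ℝ P)
    (ξ : W) (hξ : ξ ∈ interior P) (z : W) (t : ℝ) (ht : 0 < t) :
    ∀ᶠ ε : ℝ in 𝓝[>] 0, ((t - ε)⁻¹ • (z - ε • ξ) ∈ P ↔ z ∈ t • interior P) := by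
  rw [Set.mem_smul_set_iff_inv_smul_mem₀ ht.ne']
  by_cases h : t⁻¹ • z ∈ interior P
  · have hcont : ContinuousAt (fun ε : ℝ => (t - ε)⁻¹ • (z - ε • ξ)) 0 := by
      apply ContinuousAt.smul
      · apply ContinuousAt.inv₀ (by fun_prop)
        simpa using ht.ne'
      · fun_prop
    have hev := hcont.eventually_mem (s := interior P) (by
      apply isOpen_interior.mem_nhds
      simpa using h)
    filter_upwards [hev.filter_mono nhdsWithin_le_nhds] with ε hε
    exact ⟨fun _ => h, fun _ => interior_subset hε⟩
  · have hlt : ∀ᶠ ε : ℝ in 𝓝[>] 0, ε < t :=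
      (eventually_lt_nhds ht).filter_mono nhdsWithin_le_nhds
    filter_upwards [self_mem_nhdsWithin, hlt] with ε hε hεt
    have hε : 0 < ε := hε
    refine ⟨fun h' => ?_, fun h' => absurd h' h⟩
    have h0 : 0 < t - ε := sub_pos.mpr hεt
    have := hc.combo_self_interior_mem_interior h' hξ (a := (t - ε) / t) (b := ε / t)
      (by positivity) (by positivity) (by field_simp; ring)
    convert this using 1
    rw [smul_smul, div_mul_eq_mul_div, mul_inv_cancel₀ h0.ne', smul_sub, smul_smul]
    rw [one_div, div_eq_inv_mul]
    abel

end Perturb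

section Main

/-- embedding of the lattice -/
def emb (d : ℕ) : ((Fin d → ℤ) × ℤ) →+ ((Fin d → ℝ) × ℝ) where
  toFun x := (fun i => (x.1 i : ℝ), (x.2 : ℝ))
  map_zero' := by ext <;> simp
  map_add' x y := by ext <;> simp

lemma cone_iff {d : ℕ} (V : Finset (Fin d → ℤ)) (y : Fin d → ℝ) (s : ℝ) (hs : 0 < s) :
    (∃ l : V → ℝ, (∀ i, 0 ≤ l i) ∧ ∑ i, l i • emb d (i.1, 1) = (y, s)) ↔
    s⁻¹ • y ∈ convexHull ℝ
      ((fun v : Fin d → ℤ => fun i => (v i : ℝ)) '' (V : Set (Fin d → ℤ))) := by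
  have hsplit : ∀ l : V → ℝ, ∑ i, l i • emb d (i.1, 1) =
      (∑ i, l i • (fun k => (i.1 k : ℝ)), ∑ i, l i) := by
    intro l
    apply Prod.ext
    · simp [Prod.fst_sum, emb]
    · simp [Prod.snd_sum, emb]
  simp_rw [hsplit, Prod.mk.injEq]
  constructor
  · rintro ⟨l, hl, h1, h2⟩
    refine mem_convexHull_of_exists_fintype (fun i => s⁻¹ * l i) (fun i : V => fun k => (i.1 k : ℝ))
      (fun i => mul_nonneg (inv_nonneg.mpr hs.le) (hl i)) ?_ ?_ ?_
    · rw [← Finset.mul_sum, h2, inv_mul_cancel₀ hs.ne']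
    · intro i
      exact ⟨i.1, i.2, rfl⟩
    · simp_rw [mul_smul]
      rw [← Finset.smul_sum, h1]
  · intro h
    have hr : ((fun v : Fin d → ℤ => fun i => (v i : ℝ)) '' (V : Set (Fin d → ℤ))) =
        Set.range (fun i : V => fun k => (i.1 k : ℝ)) := by
      ext; simp
    rw [hr, convexHull_range_eq_exists_affineCombination] at h
    obtain ⟨S, w, hw0, hw1, hw⟩ := h
    rw [Finset.affineCombination_eq_linear_combination _ _ _ hw1] at hw
    classical
    refine ⟨fun i => if i ∈ S then s * w i else 0, ?_, ?_, ?_⟩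
    · intro i
      dsimp only
      split_ifs with hi
      · exact mul_nonneg hs.le (hw0 i hi)
      · exact le_rfl
    · simp_rw [ite_smul, zero_smul, mul_smul]
      rw [Finset.sum_ite_mem, Finset.univ_inter, ← Finset.smul_sum, hw, smul_smul,
        mul_inv_cancel₀ hs.ne', one_smul]
    · rw [Finset.sum_ite_mem, Finset.univ_inter, ← Finset.mul_sum, hw1, mul_one]

lemma span_top {d : ℕ} (V : Finset (Fin d → ℤ))
    (hfull : affineSpan ℝ (convexHull ℝ
      ((fun v : Fin d → ℤ => fun i => (v i : ℝ)) '' (V : Set (Fin d → ℤ)))) = ⊤) :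
    Submodule.span ℝ (Set.range (fun i : V => emb d (i.1, 1))) = ⊤ := by
  set M := Submodule.span ℝ (Set.range (fun i : V => emb d (i.1, 1))) with hM
  let f : (Fin d → ℝ) →ᵃ[ℝ] ((Fin d → ℝ) × ℝ) :=
    (AffineMap.id ℝ (Fin d → ℝ)).prod (AffineMap.const ℝ (Fin d → ℝ) (1 : ℝ))
  have hle : affineSpan ℝ ((fun v : Fin d → ℤ => fun i => (v i : ℝ)) '' (V : Set (Fin d → ℤ))) ≤
      M.toAffineSubspace.comap f := by
    rw [affineSpan_le]
    rintro _ ⟨v, hv, rfl⟩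
    have : emb d (v, 1) ∈ M := Submodule.subset_span ⟨⟨v, hv⟩, rfl⟩
    simpa [f, emb] using this
  rw [← affineSpan_convexHull, hfull] at hle
  have h1 : ∀ y : Fin d → ℝ, (y, (1 : ℝ)) ∈ M := by
    intro y
    have := hle (AffineSubspace.mem_top ℝ (Fin d → ℝ) y)
    simpa [f] using this
  rw [eq_top_iff]
  rintro ⟨y, s⟩ -
  have := M.add_mem (h1 y) (M.smul_mem (s - 1) (h1 0))
  simpa using this

lemma box_finite {d : ℕ} (V : Finset (Fin d → ℤ))
    (σ : GS (fun i : V => emb d (i.1, 1))) :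
    {x : (Fin d → ℤ) × ℤ | ∀ i, 0 ≤ (B σ).repr (emb d x) i ∧ (B σ).repr (emb d x) i ≤ 1}.Finite := by
  classical
  apply (Set.finite_Icc
    ((fun k => -∑ i : σ.1, |i.1.1 k|, -∑ i : σ.1, 1) : (Fin d → ℤ) × ℤ)
    ((fun k => ∑ i : σ.1, |i.1.1 k|, ∑ i : σ.1, 1) : (Fin d → ℤ) × ℤ)).subset
  intro x hx
  have hsum := B_sum σ (emb d x)
  have hk : ∀ k, |x.1 k| ≤ ∑ i : σ.1, |i.1.1 k| := by
    intro k
    have h1 := congrFun (congrArg Prod.fst hsum) k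
    simp only [emb, AddMonoidHom.coe_mk, ZeroHom.coe_mk, Prod.fst_sum, Prod.smul_mk,
      Finset.sum_apply, Pi.smul_apply, smul_eq_mul] at h1
    have h2 : |(x.1 k : ℝ)| ≤ ∑ i : σ.1, |(i.1.1 k : ℝ)| := by
      rw [← h1]
      refine (Finset.abs_sum_le_sum_abs _ _).trans (Finset.sum_le_sum fun i _ => ?_)
      rw [abs_mul]
      apply mul_le_of_le_one_left (abs_nonneg _)
      have := hx i
      rw [abs_le]
      constructor
      · exact le_trans (by norm_num) this.1
      · exact this.2
    exact_mod_cast h2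
  have h2 : |x.2| ≤ ∑ i : σ.1, (1 : ℤ) := by
    have h1 := congrArg Prod.snd hsum
    simp only [emb, AddMonoidHom.coe_mk, ZeroHom.coe_mk, Prod.snd_sum, Prod.smul_mk,
      smul_eq_mul] at h1
    have h2 : |(x.2 : ℝ)| ≤ ∑ i : σ.1, (1 : ℝ) := by
      rw [← h1]
      refine (Finset.abs_sum_le_sum_abs _ _).trans (Finset.sum_le_sum fun i _ => ?_)
      have := hx i
      rw [abs_le]
      simp only [Int.cast_one, mul_one]
      constructor
      · exact le_trans (by norm_num) this.1
      · exact this.2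
    exact_mod_cast h2
  constructor
  · exact ⟨fun k => (abs_le.mp (hk k)).1, (abs_le.mp h2).1⟩
  · exact ⟨fun k => (abs_le.mp (hk k)).2, (abs_le.mp h2).2⟩

/-- coordinates of lattice points in a basis -/
noncomputable def coordHom {d : ℕ} {V : Finset (Fin d → ℤ)} (σ : GS (fun i : V => emb d (i.1, 1))) :
    ((Fin d → ℤ) × ℤ) →+ (σ.1 → ℝ) where
  toFun x i := (B σ).repr (emb d x) i
  map_zero' := by ext; simp
  map_add' x y := by ext; simp

lemma simplicial' {d : ℕ} {V : Finset (Fin d → ℤ)} (σ : GS (fun i : V => emb d (i.1, 1)))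
    (s : σ.1 → Bool) :
    ∃ q : Polynomial ℚ, ∀ t : ℕ, 0 < t →
      Finite {z : Fin d → ℤ // ∀ i, (B σ).repr (emb d (z, t)) i ∈ J (s i)} ∧
      q.eval (t : ℚ) = Nat.card {z : Fin d → ℤ // ∀ i, (B σ).repr (emb d (z, t)) i ∈ J (s i)} ∧
      Finite {z : Fin d → ℤ // ∀ i, (B σ).repr (emb d (z, t)) i ∈ J (!(s i))} ∧
      q.eval (-(t : ℚ)) = (-1) ^ d *
        Nat.card {z : Fin d → ℤ // ∀ i, (B σ).repr (emb d (z, t)) i ∈ J (!(s i))} := by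
  classical
  have hcard : Fintype.card σ.1 = d + 1 := by
    have := Module.finrank_eq_card_basis (B σ)
    simpa using this.symm
  obtain ⟨q, hq⟩ := simplicial (κ := σ.1) d hcard (coordHom σ) (fun i => (i.1.1, 1)) (by
      intro n i
      have h1 : emb d (∑ j : σ.1, n j • ((j.1.1, 1) : (Fin d → ℤ) × ℤ)) =
          ∑ j : σ.1, (n j : ℝ) • B σ j := by
        rw [map_sum]
        apply Finset.sum_congr rfl
        intro j _
        rw [map_nsmul, B_apply, Nat.cast_smul_eq_nsmul]
      change (B σ).repr (emb d (∑ j : σ.1, n j • ((j.1.1, 1) : (Fin d → ℤ) × ℤ))) i = _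
      rw [h1, (B σ).repr_sum_self])
    (AddMonoidHom.snd _ _) (by
      intro x
      have h1 := congrArg Prod.snd (B_sum σ (emb d x))
      simp only [emb, AddMonoidHom.coe_mk, ZeroHom.coe_mk, Prod.snd_sum, Prod.smul_mk,
        smul_eq_mul, Int.cast_one, mul_one] at h1
      exact h1.symm)
    (box_finite V σ) s
  have e : ∀ (r : σ.1 → Bool) (t : ℕ),
      {x : (Fin d → ℤ) × ℤ // (∀ i, coordHom σ x i ∈ J (r i)) ∧ AddMonoidHom.snd _ _ x = (t : ℤ)} ≃
      {z : Fin d → ℤ // ∀ i, (B σ).repr (emb d (z, t)) i ∈ J (r i)} := by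
    intro r t
    exact
    { toFun := fun x => ⟨x.1.1, by
        obtain ⟨⟨z, k⟩, hx, hk⟩ := x
        have hk : k = (t : ℤ) := hk
        subst hk
        exact hx⟩
      invFun := fun z => ⟨(z.1, t), z.2, rfl⟩
      left_inv := by
        rintro ⟨⟨z, k⟩, hx, hk⟩
        have hk : k = (t : ℤ) := hk
        subst hk
        rfl
      right_inv := fun z => rfl }
  refine ⟨q, fun t ht => ?_⟩
  obtain ⟨h1, h2, h3, h4⟩ := hq t ht
  refine ⟨Finite.of_equiv _ (e s t), ?_, Finite.of_equiv _ (e (fun i => !(s i)) t), ?_⟩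
  · rw [h2, Nat.card_congr (e s t)]
  · rw [h4, Nat.card_congr (e (fun i => !(s i)) t)]

lemma exists_generic {d : ℕ} (V : Finset (Fin d → ℤ)) (P : Set (Fin d → ℝ))
    (hne : (interior P).Nonempty) :
    ∃ ξ ∈ interior P, ∀ (σ : GS (fun i : V => emb d (i.1, 1))) (i : σ.1),
      (B σ).repr (ξ, (1 : ℝ)) i ≠ 0 := by
  obtain ⟨ξ1, hξ1⟩ := hne
  have hd := dense_nonzero (E := (Fin d → ℝ) × ℝ)
    (κ := Σ σ : GS (fun i : V => emb d (i.1, 1)), σ.1) (fun k => (B k.1).coord k.2) (by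
      rintro ⟨σ, i⟩ h0
      have := LinearMap.congr_fun h0 (B σ i)
      simp at this)
  have hcont : ContinuousAt (fun x : (Fin d → ℝ) × ℝ => x.2⁻¹ • x.1) (ξ1, 1) := by
    have h1 : ContinuousAt (fun x : (Fin d → ℝ) × ℝ => x.2⁻¹) (ξ1, 1) :=
      ContinuousAt.inv₀ (by fun_prop) (by simp)
    have h2 : ContinuousAt (fun x : (Fin d → ℝ) × ℝ => x.1) (ξ1, 1) := by fun_prop
    exact h1.smul h2
  have h1 := hcont.eventually_mem (s := interior P) (by
    apply isOpen_interior.mem_nhds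
    simpa using hξ1)
  have h2 : ∀ᶠ x : (Fin d → ℝ) × ℝ in 𝓝 (ξ1, 1), x.2 ≠ 0 := by
    have : ContinuousAt (fun x : (Fin d → ℝ) × ℝ => x.2) (ξ1, 1) := by fun_prop
    exact this.eventually_ne (by simp)
  obtain ⟨x, hx, hx1, hx2⟩ :=
    ((mem_closure_iff_frequently.mp (hd (ξ1, 1))).and_eventually (h1.and h2)).exists
  refine ⟨x.2⁻¹ • x.1, hx1, fun σ i => ?_⟩
  have : ((x.2⁻¹ • x.1, (1 : ℝ)) : (Fin d → ℝ) × ℝ) = x.2⁻¹ • x := by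
    apply Prod.ext
    · rfl
    · simp [hx2]
  rw [this]
  have h3 := hx ⟨σ, i⟩
  simp only [Module.Basis.coord_apply] at h3
  simp [hx2, h3]

end Main

end EhrRec

open EhrRec Filter Topology

/-- **Ehrhart–Macdonald reciprocity.** Let `P ⊂ ℝ^d` be a lattice `d`-polytope and `p` the
polynomial with `p(t) = #(tP ∩ ℤ^d)` for all positive integers `t`. Then for every positive
integer `t`, `p(-t) = (-1)^d ⬝ #(tP° ∩ ℤ^d)`, where `P°` is the interior of `P`. -/
theorem ehrhart_macdonald_reciprocity (d : ℕ) (V : Finset (Fin d → ℤ)) (P : Set (Fin d → ℝ))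
    (hP : P = convexHull ℝ ((fun v : Fin d → ℤ => fun i => (v i : ℝ)) '' (V : Set (Fin d → ℤ))))
    (hfull : affineSpan ℝ P = ⊤)
    (p : Polynomial ℚ)
    (hp : ∀ t : ℕ, 0 < t →
      p.eval (t : ℚ) = (Nat.card {x : Fin d → ℤ // (fun i => (x i : ℝ)) ∈ (t : ℝ) • P} : ℚ)) :
    ∀ t : ℕ, 0 < t →
      p.eval (-(t : ℚ)) = (-1) ^ d *
        (Nat.card {x : Fin d → ℤ // (fun i => (x i : ℝ)) ∈ (t : ℝ) • interior P} : ℚ) := by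

  classical
  have hconv : Convex ℝ P := hP ▸ convex_convexHull ℝ _
  have hclosed : IsClosed P := by
    rw [hP]
    exact (V.finite_toSet.image _).isClosed_convexHull ℝ
  have hne : (interior P).Nonempty := hconv.interior_nonempty_iff_affineSpan_eq_top.mpr hfull
  have hspan := span_top V (by rw [← hP]; exact hfull)
  obtain ⟨T, hT⟩ := lp (fun i : V => emb d (i.1, 1)) hspan (LinearMap.snd ℝ _ _)
    (by intro i; simp [emb])
  obtain ⟨ξ, hξ, hgen⟩ := exists_generic V P hne
  have hcone := fun y s hs => cone_iff V y s hs
  rw [← hP] at hcone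
  have hnonneg : ∀ (σ : GS (fun i : V => emb d (i.1, 1))) (i : σ.1),
      (B σ).repr (-(ξ, (1 : ℝ))) i ≠ 0 := by
    intro σ i
    rw [map_neg, Finsupp.neg_apply]
    exact neg_ne_zero.mpr (hgen σ i)
  have hflip : ∀ (σ : GS (fun i : V => emb d (i.1, 1))) (i : σ.1),
      decide (0 < (B σ).repr (-(ξ, (1 : ℝ))) i) = !(decide (0 < (B σ).repr (ξ, (1 : ℝ)) i)) := by
    intro σ i
    have h1 := hgen σ i
    have h2 : (B σ).repr (-(ξ, (1 : ℝ))) i = - (B σ).repr (ξ, (1 : ℝ)) i := by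
      rw [map_neg]; rfl
    rw [h2, ← decide_not, decide_eq_decide, not_lt, neg_pos]
    exact ⟨le_of_lt, fun h => lt_of_le_of_ne h h1⟩
  -- decompositions
  have dplus : ∀ t : ℕ, 0 < t → ∀ z : Fin d → ℤ, _ := fun t ht z =>
    core _ T hT (emb d (z, t)) (ξ, 1) hgen ((fun i => (z i : ℝ)) ∈ (t : ℝ) • P) (by
      have ht' : (0 : ℝ) < t := by exact_mod_cast ht
      filter_upwards [ev_plus P hconv hclosed ξ hξ (fun i => (z i : ℝ)) t ht',
        self_mem_nhdsWithin] with ε h1 h2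
      have h2 : 0 < ε := h2
      rw [← h1, ← hcone _ _ (by positivity)]
      simp [emb])
  have dminus : ∀ t : ℕ, 0 < t → ∀ z : Fin d → ℤ, _ := fun t ht z =>
    core _ T hT (emb d (z, t)) (-(ξ, 1)) hnonneg
      ((fun i => (z i : ℝ)) ∈ (t : ℝ) • interior P) (by
      have ht' : (0 : ℝ) < t := by exact_mod_cast ht
      have hlt : ∀ᶠ ε : ℝ in 𝓝[>] 0, ε < t :=
        (eventually_lt_nhds ht').filter_mono nhdsWithin_le_nhds
      filter_upwards [ev_minus P hconv ξ hξ (fun i => (z i : ℝ)) t ht', hlt] with ε h1 h2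
      rw [← h1, ← hcone _ _ (sub_pos.mpr h2)]
      simp [emb, sub_eq_add_neg])
  simp_rw [hflip] at dminus
  haveI : Fintype T := Fintype.ofFinite T
  choose q hq using fun σ : T =>
    simplicial' σ.1 (fun i => decide (0 < (B σ.1).repr (ξ, (1 : ℝ)) i))
  have hpq : p = ∑ σ : T, q σ := by
    apply Polynomial.eq_of_infinite_eval_eq
    have hinj : Function.Injective (fun n : ℕ => ((n + 1 : ℕ) : ℚ)) := by
      intro a b hab
      have hab : ((a + 1 : ℕ) : ℚ) = ((b + 1 : ℕ) : ℚ) := hab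
      have := Nat.cast_injective hab
      omega
    apply (Set.infinite_range_of_injective hinj).mono
    rintro _ ⟨n, rfl⟩
    have ht : 0 < n + 1 := Nat.succ_pos n
    simp only [Set.mem_ofPred_eq]
    rw [hp _ ht, Polynomial.eval_finsetSum]
    rw [card_partition _ (fun (σ : T) (z : Fin d → ℤ) => ∀ i, (B σ.1).repr (emb d (z, (n + 1 : ℕ))) i ∈
      J (decide (0 < (B σ.1).repr (ξ, (1 : ℝ)) i)))
      (fun z => (dplus _ ht z).1.trans
        ⟨fun ⟨σ, h, h'⟩ => ⟨⟨σ, h⟩, h'⟩, fun ⟨σ, h⟩ => ⟨σ.1, σ.2, h⟩⟩)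
      (fun z k k' h h' => Subtype.ext ((dplus _ ht z).2 k k.2 k' k'.2 h h'))
      (fun σ => (hq σ _ ht).1)]
    rw [Nat.cast_sum]
    exact Finset.sum_congr rfl (fun σ _ => (hq σ _ ht).2.1.symm)
  intro t ht
  rw [hpq, Polynomial.eval_finsetSum]
  rw [card_partition _ (fun (σ : T) (z : Fin d → ℤ) => ∀ i, (B σ.1).repr (emb d (z, t)) i ∈
      J (!(decide (0 < (B σ.1).repr (ξ, (1 : ℝ)) i))))
      (fun z => (dminus _ ht z).1.trans
        ⟨fun ⟨σ, h, h'⟩ => ⟨⟨σ, h⟩, h'⟩, fun ⟨σ, h⟩ => ⟨σ.1, σ.2, h⟩⟩)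
      (fun z k k' h h' => Subtype.ext ((dminus _ ht z).2 k k.2 k' k'.2 h h'))
      (fun σ => (hq σ _ ht).2.2.1)]
  rw [Nat.cast_sum, Finset.mul_sum]
  exact Finset.sum_congr rfl (fun σ _ => (hq σ _ ht).2.2.2)
end

section
/- Let P be a polytope and consider the poset of all faces of P, including the empty face ∅ and P itself, ordered by inclusion, with dim ∅ := −1. Then the Möbius function of this poset satisfies μ(G, F) = (−1)^{dim F − dim G} for all faces G ⊆ F. -/
open scoped Classical

/-- `F` is a face of the polytope `P`, in the sense including the empty face `∅` and `P`
itself: either `F = ∅`, or `F` is the intersection of `P` with a hyperplane bounding a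
halfspace containing `P` (the zero functional yields `F = P`). -/
def IsPolytopeFace {n : ℕ} (P F : Set (Fin n → ℝ)) : Prop :=
  F = ∅ ∨ ∃ (a : Fin n → ℝ) (b : ℝ), (∀ x ∈ P, ∑ i, a i * x i ≤ b) ∧
    F = {x ∈ P | ∑ i, a i * x i = b}

/-- The dimension of a face: `-1` for the empty face, and otherwise the dimension of its
affine span. -/
noncomputable def faceDim' {n : ℕ} (F : Set (Fin n → ℝ)) : ℤ :=
  if F = ∅ then -1 else (Module.finrank ℝ (affineSpan ℝ F).direction : ℤ)

section Cells
open Filter Topology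

variable {W : Type*} [AddCommGroup W] [Module ℝ W]

/-- Relatively open convex cell with direction space `U`. -/
structure IsCell (U : Submodule ℝ W) (R : Set W) : Prop where
  conv : Convex ℝ R
  sub_mem : ∀ y ∈ R, ∀ y' ∈ R, y' - y ∈ U
  nhd : ∀ y ∈ R, ∀ v ∈ U, ∀ᶠ t in 𝓝 (0:ℝ), y + t • v ∈ R

noncomputable def eul (R : Set W) : ℤ :=
  if R = ∅ then 0 else (-1) ^ (Module.finrank ℝ (vectorSpan ℝ R))

lemma eul_empty : eul (∅ : Set W) = 0 := by simp [eul]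

/-- get a positive parameter from a neighbourhood of zero -/
lemma ev_pos {p : ℝ → Prop} (h : ∀ᶠ t in 𝓝 (0:ℝ), p t) : ∃ t > 0, p t ∧ p (-t) := by
  obtain ⟨ε, hε, h⟩ := Metric.eventually_nhds_iff.1 h
  refine ⟨ε/2, by positivity, h ?_, h ?_⟩ <;>
  · simp [abs_of_pos hε]; linarith

lemma ev_lin {c : ℝ} (d : ℝ) (hc : 0 < c) : ∀ᶠ t in 𝓝 (0:ℝ), 0 < c + t * d := by
  have h : ContinuousAt (fun t : ℝ => c + t * d) 0 := by fun_prop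
  exact h.eventually (lt_mem_nhds (by simpa using hc))

lemma IsCell.span_eq {U : Submodule ℝ W} {R : Set W} (h : IsCell U R) (hR : R.Nonempty) :
    vectorSpan ℝ R = U := by
  obtain ⟨y, hy⟩ := hR
  apply le_antisymm
  · rw [vectorSpan_def, Submodule.span_le]
    rintro _ ⟨a, ha, b, hb, rfl⟩
    exact h.sub_mem b hb a ha
  · intro v hv
    obtain ⟨t, ht, h1, -⟩ := ev_pos (h.nhd y hy v hv)
    have := vsub_mem_vectorSpan ℝ h1 hy
    simp only [vsub_eq_sub, add_sub_cancel_left] at this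
    have h2 := Submodule.smul_mem _ t⁻¹ this
    rwa [smul_smul, inv_mul_cancel₀ ht.ne', one_smul] at h2

lemma IsCell.eul_eq {U : Submodule ℝ W} {R : Set W} (h : IsCell U R) (hR : R.Nonempty) :
    eul R = (-1) ^ (Module.finrank ℝ U) := by
  rw [eul, if_neg hR.ne_empty, h.span_eq hR]

lemma IsCell.pos {U : Submodule ℝ W} {R : Set W} (h : IsCell U R) (a : W →ₗ[ℝ] ℝ) :
    IsCell U {w ∈ R | 0 < a w} where
  conv := by
    apply h.conv.inter
    exact convex_halfSpace_gt a.isLinear 0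
  sub_mem := fun y hy y' hy' => h.sub_mem y hy.1 y' hy'.1
  nhd := by
    intro y hy v hv
    filter_upwards [h.nhd y hy.1 v hv, ev_lin (a v) hy.2] with t h1 h2
    exact ⟨h1, by simpa using h2⟩

lemma IsCell.neg {U : Submodule ℝ W} {R : Set W} (h : IsCell U R) (a : W →ₗ[ℝ] ℝ) :
    IsCell U {w ∈ R | a w < 0} := by
  have := h.pos (-a)
  simpa using this

lemma IsCell.zero {U : Submodule ℝ W} {R : Set W} (h : IsCell U R) (a : W →ₗ[ℝ] ℝ) :
    IsCell (U ⊓ LinearMap.ker a) {w ∈ R | a w = 0} where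
  conv := by
    apply h.conv.inter
    exact convex_hyperplane a.isLinear 0
  sub_mem := fun y hy y' hy' => ⟨h.sub_mem y hy.1 y' hy'.1, by simp [hy.2, hy'.2]⟩
  nhd := by
    intro y hy v hv
    filter_upwards [h.nhd y hy.1 v hv.1] with t h1
    have : a v = 0 := hv.2
    exact ⟨h1, by simp [hy.2, this]⟩

lemma finrank_inf_ker [FiniteDimensional ℝ W] (U : Submodule ℝ W) (a : W →ₗ[ℝ] ℝ) {u : W}
    (hu : u ∈ U) (ha : a u ≠ 0) :
    Module.finrank ℝ (U ⊓ LinearMap.ker a : Submodule ℝ W) + 1 = Module.finrank ℝ U := by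
  have h := LinearMap.finrank_range_add_finrank_ker (a.domRestrict U)
  have hs : LinearMap.range (a.domRestrict U) = ⊤ := by
    apply LinearMap.range_eq_top.2
    intro r
    refine ⟨(r / a u) • ⟨u, hu⟩, ?_⟩
    simp [ha]
  have hk : Module.finrank ℝ (LinearMap.ker (a.domRestrict U))
      = Module.finrank ℝ (U ⊓ LinearMap.ker a : Submodule ℝ W) := by
    have : (U ⊓ LinearMap.ker a : Submodule ℝ W)
        = (LinearMap.ker (a.domRestrict U)).map U.subtype := by
      ext w
      simp [and_comm]
    rw [this]
    exact (LinearEquiv.finrank_eq (Submodule.equivMapOfInjective _ U.injective_subtype _))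
  rw [hs, hk] at h
  simp at h
  omega

lemma eul_split [FiniteDimensional ℝ W] {U : Submodule ℝ W} {R : Set W} (h : IsCell U R)
    (a : W →ₗ[ℝ] ℝ) :
    eul R = eul {w ∈ R | 0 < a w} + eul {w ∈ R | a w = 0} + eul {w ∈ R | a w < 0} := by
  rcases R.eq_empty_or_nonempty with rfl | hR
  · simp [eul_empty]
  have triv : (∀ w ∈ R, 0 < a w) ∨ (∀ w ∈ R, a w = 0) ∨ (∀ w ∈ R, a w < 0) →
      eul R = eul {w ∈ R | 0 < a w} + eul {w ∈ R | a w = 0} + eul {w ∈ R | a w < 0} := by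
    have full : ∀ p : W → Prop, (∀ w ∈ R, p w) → {w ∈ R | p w} = R := by
      intro p hp; ext w; exact ⟨fun h => h.1, fun h => ⟨h, hp w h⟩⟩
    have emp : ∀ p : W → Prop, (∀ w ∈ R, ¬ p w) → {w ∈ R | p w} = ∅ := by
      intro p hp; ext w; exact ⟨fun h => hp w h.1 h.2, fun h => h.elim⟩
    rintro (H | H | H)
    · rw [full _ H, emp _ (fun w hw => (H w hw).ne'), emp _ (fun w hw => (H w hw).le.not_gt)]
      simp [eul_empty]
    · rw [full _ H, emp _ (fun w hw => (H w hw).not_gt), emp _ (fun w hw => (H w hw).not_lt)]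
      simp [eul_empty]
    · rw [full _ H, emp _ (fun w hw => (H w hw).ne), emp _ (fun w hw => (H w hw).le.not_gt)]
      simp [eul_empty]
  by_cases h0 : ∃ y ∈ R, a y = 0
  · obtain ⟨y, hy, hay⟩ := h0
    by_cases hU : ∃ u ∈ U, a u ≠ 0
    · obtain ⟨u, hu, hau⟩ := hU
      obtain ⟨t, ht, h1, h2⟩ := ev_pos (h.nhd y hy (a u • u) (U.smul_mem _ hu))
      have hpos : 0 < t * (a u * a u) := mul_pos ht (mul_self_pos.2 hau)
      have e1 := (h.pos a).eul_eq ⟨_, h1, by simp [hay]; exact hpos⟩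
      have e2 := (h.neg a).eul_eq ⟨_, h2, by simp [hay]; exact hpos⟩
      have e3 := (h.zero a).eul_eq ⟨y, hy, hay⟩
      rw [e1, e2, e3, h.eul_eq hR, ← finrank_inf_ker U a hu hau, pow_succ]
      ring
    · push Not at hU
      apply triv; right; left
      intro w hw
      have := hU _ (h.sub_mem y hy w hw)
      rw [map_sub, hay, sub_zero] at this; exact this
  · push Not at h0
    apply triv
    by_contra! hc
    obtain ⟨⟨p, hp, hp'⟩, -, ⟨q, hq, hq'⟩⟩ := hc
    have hp2 : a p < 0 := lt_of_le_of_ne hp' (h0 p hp)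
    have hq2 : 0 < a q := lt_of_le_of_ne hq' (h0 q hq).symm
    have hs : 0 < a q - a p := by linarith
    have := h.conv hp hq (a := a q / (a q - a p)) (b := - a p / (a q - a p)) (by positivity)
      (div_nonneg (by linarith) hs.le) (by field_simp; ring)
    apply h0 _ this
    simp
    field_simp
    ring

/-- sum of signs over all the sign cells of a list of functionals -/
noncomputable def chi : List (W →ₗ[ℝ] ℝ) → Set W → ℤ
  | [], R => eul R
  | a :: A, R => chi A {w ∈ R | 0 < a w} + chi A {w ∈ R | a w = 0} + chi A {w ∈ R | a w < 0}

lemma chi_eq [FiniteDimensional ℝ W] (A : List (W →ₗ[ℝ] ℝ)) :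
    ∀ {U : Submodule ℝ W} {R : Set W}, IsCell U R → chi A R = eul R := by
  induction A with
  | nil => intros; rfl
  | cons a A ih =>
    intro U R h
    rw [chi, ih (h.pos a), ih (h.neg a), ih (h.zero a), eul_split h a]

lemma chi_empty (A : List (W →ₗ[ℝ] ℝ)) : chi A (∅ : Set W) = 0 := by
  induction A with
  | nil => exact eul_empty
  | cons a A ih => simp [chi, ih]

lemma chi_sum {ι : Type*} (s : Finset ι) (A : List (W →ₗ[ℝ] ℝ)) :
    ∀ (R : Set W) (K : ι → Set W), (∀ w, w ∈ R ↔ ∃ i ∈ s, w ∈ K i) →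
      (∀ i ∈ s, ∀ j ∈ s, i ≠ j → ∀ w ∈ K i, ∀ w' ∈ K j,
        ∃ a ∈ A, SignType.sign (a w) ≠ SignType.sign (a w')) →
      chi A R = ∑ i ∈ s, chi A (K i) := by
  induction A with
  | nil =>
    intro R K hR hsep
    rcases R.eq_empty_or_nonempty with rfl | ⟨w, hw⟩
    · symm
      rw [chi_empty]
      apply Finset.sum_eq_zero
      intro i hi
      have : K i = ∅ := by
        ext w
        have := hR w
        simp at this ⊢
        exact this i hi
      rw [this, chi_empty]
    · obtain ⟨i, hi, hwi⟩ := (hR w).1 hw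
      have hK : ∀ j ∈ s, j ≠ i → K j = ∅ := by
        intro j hj hji
        ext w'
        simp only [Set.mem_empty_iff_false, iff_false]
        intro hw'
        obtain ⟨a, ha, -⟩ := hsep i hi j hj hji.symm w hwi w' hw'
        simp at ha
      rw [Finset.sum_eq_single_of_mem i hi (fun j hj hji => by rw [hK j hj hji, chi_empty])]
      congr 1
      ext w'
      rw [hR]
      constructor
      · rintro ⟨j, hj, h⟩
        by_cases hji : j = i
        · rwa [← hji]
        · rw [hK j hj hji] at h; exact h.elim
      · exact fun h => ⟨i, hi, h⟩
  | cons a A ih =>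
    intro R K hR hsep
    have key : ∀ p : ℝ → Prop, (∀ x y, p x → p y → SignType.sign x = SignType.sign y) →
        chi A {w ∈ R | p (a w)} = ∑ i ∈ s, chi A {w ∈ K i | p (a w)} := by
      intro p hp
      apply ih
      · intro w
        simp only [Set.mem_ofPred_eq, hR]
        constructor
        · rintro ⟨⟨i, hi, h⟩, h'⟩; exact ⟨i, hi, h, h'⟩
        · rintro ⟨i, hi, h, h'⟩; exact ⟨⟨i, hi, h⟩, h'⟩
      · intro i hi j hj hij w hw w' hw'
        obtain ⟨b, hb, hne⟩ := hsep i hi j hj hij w hw.1 w' hw'.1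
        rcases List.mem_cons.1 hb with rfl | hb
        · exact absurd (hp _ _ hw.2 hw'.2) hne
        · exact ⟨b, hb, hne⟩
    simp only [chi, Finset.sum_add_distrib]
    rw [key (fun x => 0 < x), key (fun x => x = 0), key (fun x => x < 0)]
    · intro x y hx hy; rw [sign_neg hx, sign_neg hy]
    · intro x y hx hy; rw [hx, hy]
    · intro x y hx hy; rw [sign_pos hx, sign_pos hy]

/-- common kernel -/
def kerAll (T : Finset (W →ₗ[ℝ] ℝ)) : Submodule ℝ W where
  carrier := {w | ∀ a ∈ T, a w = 0}
  add_mem' := by intro x y hx hy a ha; simp [hx a ha, hy a ha]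
  zero_mem' := by intro a _; simp
  smul_mem' := by intro c x hx a ha; simp [hx a ha]

lemma mem_kerAll {T : Finset (W →ₗ[ℝ] ℝ)} {w : W} : w ∈ kerAll T ↔ ∀ a ∈ T, a w = 0 := Iff.rfl

def cellOf (U : Submodule ℝ W) (J T : Finset (W →ₗ[ℝ] ℝ)) : Set W :=
  {w | w ∈ U ∧ (∀ a ∈ T, a w = 0) ∧ ∀ a ∈ J \ T, 0 < a w}

lemma isCell_cellOf (U : Submodule ℝ W) (J T : Finset (W →ₗ[ℝ] ℝ)) :
    IsCell (U ⊓ kerAll T) (cellOf U J T) where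
  conv := by
    rintro w ⟨h1, h2, h3⟩ w' ⟨h1', h2', h3'⟩ s t hs ht hst
    refine ⟨U.add_mem (U.smul_mem _ h1) (U.smul_mem _ h1'), ?_, ?_⟩
    · intro a ha; simp [h2 a ha, h2' a ha]
    · intro a ha
      exact convex_halfSpace_gt a.isLinear 0 (h3 a ha) (h3' a ha) hs ht hst
  sub_mem := by
    rintro w ⟨h1, h2, h3⟩ w' ⟨h1', h2', h3'⟩
    refine ⟨U.sub_mem h1' h1, ?_⟩
    intro a ha; simp [h2 a ha, h2' a ha]
  nhd := by
    rintro w ⟨h1, h2, h3⟩ v ⟨hv, hv'⟩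
    have : ∀ᶠ t in 𝓝 (0:ℝ), ∀ a ∈ J \ T, 0 < a w + t * a v :=
      (Filter.eventually_all_finset _).2 fun a ha => ev_lin (a v) (h3 a ha)
    filter_upwards [this] with t ht
    refine ⟨U.add_mem h1 (U.smul_mem _ hv), ?_, ?_⟩
    · intro a ha; simp [h2 a ha, hv' a ha]
    · intro a ha; simpa using ht a ha

/-- the cell modulo the line through `x`; functionals normalised to `a w / a x` -/
def lineCell (U : Submodule ℝ W) (x : W) (J T : Finset (W →ₗ[ℝ] ℝ)) : Set W :=
  {w | w ∈ U ∧ ∃ m : ℝ, (∀ a ∈ T, a w = m * a x) ∧ ∀ a ∈ J \ T, m * a x < a w}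

def lineSpace (U : Submodule ℝ W) (x : W) (T : Finset (W →ₗ[ℝ] ℝ)) : Submodule ℝ W where
  carrier := {w | w ∈ U ∧ ∃ m : ℝ, ∀ a ∈ T, a w = m * a x}
  add_mem' := by
    rintro v w ⟨h, m, hm⟩ ⟨h', m', hm'⟩
    exact ⟨U.add_mem h h', m + m', fun a ha => by simp [hm a ha, hm' a ha]; ring⟩
  zero_mem' := ⟨U.zero_mem, 0, by simp⟩
  smul_mem' := by
    rintro c v ⟨h, m, hm⟩
    exact ⟨U.smul_mem c h, c * m, fun a ha => by simp [hm a ha]; ring⟩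

lemma isCell_lineCell (U : Submodule ℝ W) (x : W) (J T : Finset (W →ₗ[ℝ] ℝ)) :
    IsCell (lineSpace U x T) (lineCell U x J T) where
  conv := by
    rintro w ⟨h1, m, h2, h3⟩ w' ⟨h1', m', h2', h3'⟩ s t hs ht hst
    refine ⟨U.add_mem (U.smul_mem _ h1) (U.smul_mem _ h1'), s * m + t * m', ?_, ?_⟩
    · intro a ha; simp [h2 a ha, h2' a ha]; ring
    · intro a ha
      have := convex_Ioi (0:ℝ) (sub_pos.2 (h3 a ha)) (sub_pos.2 (h3' a ha)) hs ht hst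
      simp at this ⊢
      linarith
  sub_mem := by
    rintro w ⟨h1, m, h2, h3⟩ w' ⟨h1', m', h2', h3'⟩
    refine ⟨U.sub_mem h1' h1, m' - m, ?_⟩
    intro a ha; simp [h2 a ha, h2' a ha]; ring
  nhd := by
    rintro w ⟨h1, m, h2, h3⟩ v ⟨hv, n, hv'⟩
    have : ∀ᶠ t in 𝓝 (0:ℝ), ∀ a ∈ J \ T, 0 < (a w - m * a x) + t * (a v - n * a x) :=
      (Filter.eventually_all_finset _).2 fun a ha => ev_lin _ (sub_pos.2 (h3 a ha))
    filter_upwards [this] with t ht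
    refine ⟨U.add_mem h1 (U.smul_mem _ hv), m + t * n, ?_, ?_⟩
    · intro a ha; simp [h2 a ha, hv' a ha]; ring
    · intro a ha
      have := ht a ha
      simp
      linarith

lemma isCell_sub (U : Submodule ℝ W) : IsCell U (U : Set W) where
  conv := U.convex
  sub_mem := fun _ hy _ hy' => U.sub_mem hy' hy
  nhd := fun _ hy _ hv => Filter.Eventually.of_forall fun _ => U.add_mem hy (U.smul_mem _ hv)

lemma eul_lineCell [FiniteDimensional ℝ W] (U : Submodule ℝ W) {x : W} (hx : x ∈ U)
    {J T : Finset (W →ₗ[ℝ] ℝ)}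
    (hJ : ∀ a ∈ J, 0 < a x) (hT : T ⊆ J) (hT0 : T.Nonempty) :
    eul (lineCell U x J T) = - eul (cellOf U J T) := by
  obtain ⟨b, hb⟩ := hT0
  by_cases hne : (cellOf U J T).Nonempty
  · have hne' : (lineCell U x J T).Nonempty := by
      obtain ⟨w, h1, h2, h3⟩ := hne
      exact ⟨w, h1, 0, by simpa using h2, by simpa using h3⟩
    rw [(isCell_cellOf U J T).eul_eq hne, (isCell_lineCell U x J T).eul_eq hne']
    have : U ⊓ kerAll T = lineSpace U x T ⊓ LinearMap.ker b := by
      ext w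
      constructor
      · rintro ⟨h1, h2⟩
        exact ⟨⟨h1, 0, by simpa using mem_kerAll.1 h2⟩, h2 b hb⟩
      · rintro ⟨⟨h1, m, h2⟩, h3⟩
        refine ⟨h1, ?_⟩
        have h4 : b w = 0 := h3
        rw [h2 b hb] at h4
        have hm : m = 0 := (mul_eq_zero.1 h4).resolve_right (hJ b (hT hb)).ne'
        intro a ha
        rw [h2 a ha, hm, zero_mul]
    rw [this, ← finrank_inf_ker (lineSpace U x T) b (u := x) ⟨hx, 1, by simp⟩ (hJ b (hT hb)).ne',
      pow_succ]
    ring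
  · have hne' : ¬ (lineCell U x J T).Nonempty := by
      rintro ⟨w, h1, m, h2, h3⟩
      apply hne
      refine ⟨w - m • x, U.sub_mem h1 (U.smul_mem _ hx), ?_, ?_⟩
      · intro a ha; simp [h2 a ha]
      · intro a ha; simpa using h3 a ha
    rw [Set.not_nonempty_iff_eq_empty] at hne hne'
    simp [hne, hne', eul_empty]

lemma sum_cells [FiniteDimensional ℝ W] (U : Submodule ℝ W) {x : W} (hx : x ∈ U)
    {J : Finset (W →ₗ[ℝ] ℝ)} (hJ : ∀ a ∈ J, 0 < a x) (hJ0 : J.Nonempty) :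
    ∑ T ∈ J.powerset, eul (cellOf U J T) = 0 := by
  let A : List (W →ₗ[ℝ] ℝ) := ((J ×ˢ J).image (fun p => (p.2 x) • p.1 - (p.1 x) • p.2)).toList
  have hA : ∀ b ∈ J, ∀ c ∈ J, c x • b - b x • c ∈ A := by
    intro b hb c hc
    simp only [A, Finset.mem_toList, Finset.mem_image]
    exact ⟨(b, c), Finset.mem_product.2 ⟨hb, hc⟩, rfl⟩
  -- separation of distinct cells
  have hkey : ∀ T ⊆ J, ∀ T' ⊆ J, T'.Nonempty → ∀ w ∈ lineCell U x J T, ∀ w' ∈ lineCell U x J T',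
      ¬ T ⊆ T' → ∃ a ∈ A, a w ≤ 0 ∧ 0 < a w' := by
    rintro T hT T' hT' ⟨c, hc⟩ w ⟨-, m, h2, h3⟩ w' ⟨-, m', h2', h3'⟩ hn
    obtain ⟨b, hb, hb'⟩ := Finset.not_subset.1 hn
    refine ⟨_, hA b (hT hb) c (hT' hc), ?_, ?_⟩
    · have hcw : m * c x ≤ c w := by
        by_cases hcT : c ∈ T
        · exact (h2 c hcT).ge
        · exact (h3 c (Finset.mem_sdiff.2 ⟨hT' hc, hcT⟩)).le
      have := mul_le_mul_of_nonneg_left hcw (hJ b (hT hb)).le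
      simp [h2 b hb]
      linarith
    · have := mul_lt_mul_of_pos_left (h3' b (Finset.mem_sdiff.2 ⟨hT hb, hb'⟩)) (hJ c (hT' hc))
      simp [h2' c hc]
      linarith
  have hsum := chi_sum (J.powerset.erase ∅) A (U : Set W) (lineCell U x J) (by
    intro w
    constructor
    · intro hw
      obtain ⟨b, hb, hmin⟩ := J.exists_min_image (fun a => a w / a x) hJ0
      refine ⟨J.filter (fun a => a w / a x = b w / b x), ?_, hw, b w / b x, ?_, ?_⟩
      · simp only [Finset.mem_erase, Finset.mem_powerset]
        refine ⟨Finset.nonempty_iff_ne_empty.1 ⟨b, by simp [hb]⟩, Finset.filter_subset _ _⟩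
      · intro a ha
        rw [Finset.mem_filter] at ha
        rw [← ha.2, div_mul_cancel₀ _ (hJ a ha.1).ne']
      · intro a ha
        simp only [Finset.mem_sdiff, Finset.mem_filter, not_and] at ha
        rw [← lt_div_iff₀ (hJ a ha.1)]
        exact lt_of_le_of_ne (hmin a ha.1) (Ne.symm (ha.2 ha.1))
    · rintro ⟨T, -, h⟩; exact h.1) (by
    intro T hT T' hT' hne w hw w' hw'
    simp only [Finset.mem_erase, Finset.mem_powerset] at hT hT'
    by_cases hs : T ⊆ T'
    · have hs' : ¬ T' ⊆ T := fun h => hne (hs.antisymm h)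
      obtain ⟨a, ha, h1, h2⟩ := hkey T' hT'.2 T hT.2 (Finset.nonempty_iff_ne_empty.2 hT.1) w' hw' w hw hs'
      refine ⟨a, ha, fun h => ?_⟩
      rw [sign_pos h2] at h
      exact h1.not_gt (sign_eq_one_iff.1 h.symm)
    · obtain ⟨a, ha, h1, h2⟩ := hkey T hT.2 T' hT'.2 (Finset.nonempty_iff_ne_empty.2 hT'.1) w hw w' hw' hs
      refine ⟨a, ha, fun h => ?_⟩
      rw [sign_pos h2] at h
      exact h1.not_gt (sign_eq_one_iff.1 h))
  rw [chi_eq A (isCell_sub U)] at hsum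
  have h1 : ∀ T ∈ J.powerset.erase ∅, chi A (lineCell U x J T) = - eul (cellOf U J T) := by
    intro T hT
    simp only [Finset.mem_erase, Finset.mem_powerset] at hT
    rw [chi_eq A (isCell_lineCell U x J T),
      eul_lineCell U hx hJ hT.2 (Finset.nonempty_iff_ne_empty.2 hT.1)]
  rw [Finset.sum_congr rfl h1, Finset.sum_neg_distrib] at hsum
  rw [← Finset.add_sum_erase _ _ (Finset.empty_mem_powerset J)]
  have h2 : eul (cellOf U J ∅) = eul (U : Set W) := by
    rw [(isCell_cellOf U J ∅).eul_eq ⟨x, hx, by simp, by simpa using hJ⟩,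
      (isCell_sub U).eul_eq ⟨x, hx⟩]
    have : U ⊓ kerAll ∅ = U := by
      ext w; simp [mem_kerAll]
    rw [this]
  rw [h2, hsum]; ring

/-- Weyl's theorem by Fourier-Motzkin elimination -/
lemma weyl [FiniteDimensional ℝ W] (S : Finset W) : ∃ A : Finset (W →ₗ[ℝ] ℝ), ∀ w,
    (∃ c : W → ℝ, (∀ v ∈ S, 0 ≤ c v) ∧ w = ∑ v ∈ S, c v • v) ↔ ∀ a ∈ A, 0 ≤ a w := by
  induction S using Finset.induction_on with
  | empty =>
    let b := Module.finBasis ℝ W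
    refine ⟨Finset.univ.image (fun i => b.coord i) ∪ Finset.univ.image (fun i => - b.coord i), ?_⟩
    intro w
    simp only [Finset.notMem_empty, Finset.sum_empty, Finset.mem_union, Finset.mem_image,
      Finset.mem_univ, true_and]
    constructor
    · rintro ⟨-, -, rfl⟩; simp
    · intro h
      refine ⟨0, by simp, b.ext_elem fun i => ?_⟩
      have h1 := h _ (Or.inl ⟨i, rfl⟩)
      have h2 := h _ (Or.inr ⟨i, rfl⟩)
      simp at h1 h2 ⊢
      linarith
  | insert u S hu ih =>
    obtain ⟨A, hA⟩ := ih
    refine ⟨A.filter (fun a => 0 ≤ a u) ∪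
      (((A.filter fun a => 0 < a u) ×ˢ (A.filter fun a => a u < 0)).image
        fun p => p.1 u • p.2 - p.2 u • p.1), ?_⟩
    intro w
    have h1 : (∃ c : W → ℝ, (∀ v ∈ insert u S, 0 ≤ c v) ∧ w = ∑ v ∈ insert u S, c v • v) ↔
        ∃ t : ℝ, 0 ≤ t ∧ ∀ a ∈ A, 0 ≤ a (w - t • u) := by
      constructor
      · rintro ⟨c, hc, rfl⟩
        refine ⟨c u, hc u (by simp), (hA _).1 ⟨c, fun v hv => hc v (by simp [hv]), ?_⟩⟩
        rw [Finset.sum_insert hu]; abel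
      · rintro ⟨t, ht, h⟩
        obtain ⟨c, hc, h⟩ := (hA _).2 h
        refine ⟨fun v => if v = u then t else c v, ?_, ?_⟩
        · intro v hv
          by_cases hvu : v = u
          · simp [hvu, ht]
          · simp only [hvu, if_false]; exact hc v ((Finset.mem_insert.1 hv).resolve_left hvu)
        · rw [Finset.sum_insert hu, Finset.sum_congr rfl (g := fun v => c v • v), ← h]
          · simp
          · intro v hv
            have : v ≠ u := fun h => hu (h ▸ hv)
            simp [this]
    rw [h1]
    constructor
    · rintro ⟨t, ht, h⟩ a ha
      simp only [Finset.mem_union, Finset.mem_filter, Finset.mem_image, Finset.mem_product] at ha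
      rcases ha with ⟨ha, hau⟩ | ⟨⟨p, q⟩, ⟨⟨hp, hpu⟩, ⟨hq, hqu⟩⟩, rfl⟩
      · have := h a ha
        simp at this
        nlinarith
      · have h2 := h p hp
        have h3 := h q hq
        simp at h2 h3 hpu hqu ⊢
        nlinarith
    · intro h
      simp only [Finset.mem_union, Finset.mem_filter, Finset.mem_image, Finset.mem_product] at h
      let Lo : Finset ℝ := insert 0 ((A.filter fun a => a u < 0).image fun a => a w / a u)
      have hLo : Lo.Nonempty := ⟨0, by simp [Lo]⟩
      refine ⟨Lo.max' hLo, Lo.le_max' 0 (by simp [Lo]), ?_⟩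
      intro a ha
      rw [map_sub, map_smul, smul_eq_mul, sub_nonneg]
      rcases lt_trichotomy (a u) 0 with hau | hau | hau
      · have := Lo.le_max' (a w / a u) (by
          simp only [Lo, Finset.mem_insert, Finset.mem_image, Finset.mem_filter]
          exact Or.inr ⟨a, ⟨ha, hau⟩, rfl⟩)
        exact (div_le_iff_of_neg hau).1 this
      · rw [hau, mul_zero]
        exact h a (Or.inl ⟨ha, hau.ge⟩)
      · rw [← le_div_iff₀ hau]
        apply Finset.max'_le
        intro l hl
        simp only [Lo, Finset.mem_insert, Finset.mem_image, Finset.mem_filter] at hl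
        rcases hl with rfl | ⟨q, ⟨hq, hqu⟩, rfl⟩
        · exact div_nonneg (h a (Or.inl ⟨ha, hau.le⟩)) hau.le
        · have := h _ (Or.inr ⟨(a, q), ⟨⟨ha, hau⟩, ⟨hq, hqu⟩⟩, rfl⟩)
          simp at this
          rw [div_le_iff_of_neg hqu, div_mul_eq_mul_div, div_le_iff₀ hau]
          linarith

end Cells

section Poly
open Filter Topology

lemma cone_poly {n : ℕ} (Vs : Finset (Fin n → ℝ)) :
    ∃ A : Finset (((Fin n → ℝ) × ℝ) →ₗ[ℝ] ℝ), ∀ w,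
      (∀ a ∈ A, 0 ≤ a w) ↔ ∃ c : (Fin n → ℝ) → ℝ, (∀ v ∈ Vs, 0 ≤ c v) ∧
        w = ∑ v ∈ Vs, c v • ((v, 1) : (Fin n → ℝ) × ℝ) := by
  obtain ⟨A, hA⟩ := weyl (Vs.image fun v => ((v, 1) : (Fin n → ℝ) × ℝ))
  refine ⟨A, fun w => ?_⟩
  rw [← hA]
  have inj : Set.InjOn (fun v => ((v, 1) : (Fin n → ℝ) × ℝ)) (Vs : Set (Fin n → ℝ)) := by
    intro v _ v' _ h
    exact congrArg Prod.fst h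
  constructor
  · rintro ⟨c, hc, h⟩
    refine ⟨fun v => c (v, 1), fun v hv => hc _ (Finset.mem_image_of_mem _ hv), ?_⟩
    rwa [Finset.sum_image inj] at h
  · rintro ⟨c, hc, h⟩
    refine ⟨fun p => c p.1, ?_, ?_⟩
    · intro p hp
      obtain ⟨v, hv, rfl⟩ := Finset.mem_image.1 hp
      exact hc v hv
    · rwa [Finset.sum_image inj]

variable {n : ℕ}

/-- `A` is a list of homogeneous inequalities describing the cone over `P`. -/
structure Desc (P : Set (Fin n → ℝ)) (A : Finset (((Fin n → ℝ) × ℝ) →ₗ[ℝ] ℝ)) : Prop where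
  mem : ∀ x, x ∈ P ↔ ∀ a ∈ A, 0 ≤ a (x, 1)
  cone : ∀ w, (∀ a ∈ A, 0 ≤ a w) → w = 0 ∨ ∃ s > (0:ℝ), ∃ x ∈ P, w = s • ((x, 1) : (Fin n → ℝ) × ℝ)

lemma exists_desc (Vs : Finset (Fin n → ℝ)) :
    ∃ A, Desc (convexHull ℝ (Vs : Set (Fin n → ℝ))) A := by
  obtain ⟨A, hA⟩ := cone_poly Vs
  have hmem : ∀ x, x ∈ convexHull ℝ (Vs : Set (Fin n → ℝ)) ↔ ∀ a ∈ A, 0 ≤ a (x, 1) := by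
    intro x
    rw [hA, Finset.mem_convexHull']
    constructor
    · rintro ⟨c, hc, h1, h2⟩
      refine ⟨c, hc, ?_⟩
      ext1
      · simp [Prod.fst_sum, h2]
      · simp [Prod.snd_sum, h1]
    · rintro ⟨c, hc, h⟩
      refine ⟨c, hc, ?_, ?_⟩
      · have := congrArg Prod.snd h
        simp [Prod.snd_sum] at this
        exact this.symm
      · have := congrArg Prod.fst h
        simp only [Prod.fst_sum, Prod.smul_fst] at this
        exact this.symm
  refine ⟨A, hmem, ?_⟩
  intro w hw
  obtain ⟨c, hc, h⟩ := (hA w).1 hw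
  have hs : w.2 = ∑ v ∈ Vs, c v := by
    rw [h]; simp [Prod.snd_sum]
  rcases (Finset.sum_nonneg hc).eq_or_lt with h0 | h0
  · left
    have := (Finset.sum_eq_zero_iff_of_nonneg hc).1 h0.symm
    rw [h]
    apply Finset.sum_eq_zero
    intro v hv
    rw [this v hv, zero_smul]
  · right
    rw [← hs] at h0
    have e : w = w.2 • ((w.2⁻¹ • w.1, 1) : (Fin n → ℝ) × ℝ) := by
      ext1
      · simp [smul_smul, h0.ne']
      · simp
    refine ⟨w.2, h0, w.2⁻¹ • w.1, ?_, e⟩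
    rw [hmem]
    intro a ha
    have := hw a ha
    rw [e, map_smul, smul_eq_mul] at this
    exact nonneg_of_mul_nonneg_right this h0

/-- tight inequalities -/
noncomputable def tt (A : Finset (((Fin n → ℝ) × ℝ) →ₗ[ℝ] ℝ)) (w : (Fin n → ℝ) × ℝ) :
    Finset (((Fin n → ℝ) × ℝ) →ₗ[ℝ] ℝ) := A.filter fun a => a w = 0

def Real' (A T : Finset (((Fin n → ℝ) × ℝ) →ₗ[ℝ] ℝ)) : Prop :=
  ∃ w, (∀ a ∈ A, 0 ≤ a w) ∧ tt A w = T

def Phi (A T : Finset (((Fin n → ℝ) × ℝ) →ₗ[ℝ] ℝ)) : Set (Fin n → ℝ) :=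
  {x | (∀ a ∈ A, 0 ≤ a (x, 1)) ∧ ∀ a ∈ T, a (x, 1) = 0}

variable {P : Set (Fin n → ℝ)} {A : Finset (((Fin n → ℝ) × ℝ) →ₗ[ℝ] ℝ)}

lemma mem_tt {w : (Fin n → ℝ) × ℝ} {a : ((Fin n → ℝ) × ℝ) →ₗ[ℝ] ℝ} :
    a ∈ tt A w ↔ a ∈ A ∧ a w = 0 := Finset.mem_filter

lemma Real'.sub {T : Finset (((Fin n → ℝ) × ℝ) →ₗ[ℝ] ℝ)} (h : Real' A T) : T ⊆ A := by
  obtain ⟨w, -, rfl⟩ := h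
  exact Finset.filter_subset _ _

/-- a realised tight set is either everything or realised by a point of `P` -/
lemma Desc.real_cases (hD : Desc P A) {T : Finset (((Fin n → ℝ) × ℝ) →ₗ[ℝ] ℝ)} (h : Real' A T) :
    T = A ∨ ∃ y, (∀ a ∈ A, 0 ≤ a (y, 1)) ∧ tt A (y, 1) = T := by
  obtain ⟨w, hw, rfl⟩ := h
  rcases hD.cone w hw with rfl | ⟨s, hs, x, hx, rfl⟩
  · left; simp [tt]
  · right
    refine ⟨x, (hD.mem x).1 hx, ?_⟩
    ext a
    rw [mem_tt, mem_tt, map_smul, smul_eq_mul, mul_eq_zero, or_iff_right hs.ne']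

lemma Desc.phi_full (hD : Desc P A) : Phi A A = ∅ := by
  ext x
  simp only [Set.mem_empty_iff_false, iff_false]
  rintro ⟨h1, h2⟩
  have h3 : ∀ a ∈ A, 0 ≤ a (-((x, 1) : (Fin n → ℝ) × ℝ)) := by
    intro a ha; rw [map_neg, h2 a ha, neg_zero]
  rcases hD.cone _ h3 with h | ⟨s, hs, y, hy, h⟩
  · have := congrArg Prod.snd h
    simp at this
  · have := congrArg Prod.snd h
    simp at this
    linarith

lemma Desc.phi_sub (hD : Desc P A) {T T' : Finset (((Fin n → ℝ) × ℝ) →ₗ[ℝ] ℝ)} (h : Real' A T)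
    (h' : Real' A T') : Phi A T ⊆ Phi A T' ↔ T' ⊆ T := by
  constructor
  · intro hs
    rcases hD.real_cases h with rfl | ⟨y, hy, rfl⟩
    · exact h'.sub
    · intro a ha
      exact mem_tt.2 ⟨h'.sub ha, (hs ⟨hy, fun b hb => (mem_tt.1 hb).2⟩).2 a ha⟩
  · intro hs x hx
    exact ⟨hx.1, fun a ha => hx.2 a (hs ha)⟩

lemma lin_coord (a : ((Fin n → ℝ) × ℝ) →ₗ[ℝ] ℝ) (x : Fin n → ℝ) :
    a (x, 1) = ∑ i, a (Pi.single i 1, 0) * x i + a (0, 1) := by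
  have h1 : ((x, 1) : (Fin n → ℝ) × ℝ) = (x, 0) + (0, 1) := by simp
  have h2 : a (x, 0) = (a ∘ₗ LinearMap.inl ℝ (Fin n → ℝ) ℝ) x := by simp
  rw [h1, map_add, h2, LinearMap.pi_apply_eq_sum_univ]
  congr 1
  apply Finset.sum_congr rfl
  intro i _
  simp only [LinearMap.comp_apply, LinearMap.inl_apply, smul_eq_mul]
  rw [mul_comm]
  congr 3
  ext j
  simp [Pi.single_apply, eq_comm]

lemma Desc.phi_face (hD : Desc P A) {T : Finset (((Fin n → ℝ) × ℝ) →ₗ[ℝ] ℝ)} (hT : T ⊆ A) :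
    IsPolytopeFace P (Phi A T) := by
  right
  let f : ((Fin n → ℝ) × ℝ) →ₗ[ℝ] ℝ := ∑ a ∈ T, a
  have hf : ∀ w, f w = ∑ a ∈ T, a w := fun w => by simp [f]
  have hx : ∀ x, ∑ i, (-f (Pi.single i 1, 0)) * x i = f (0, 1) - f (x, 1) := by
    intro x
    rw [lin_coord f x]
    simp
  refine ⟨fun i => - f (Pi.single i 1, 0), f (0, 1), ?_, ?_⟩
  · intro x hxP
    rw [hx, hf (x, 1)]
    have := Finset.sum_nonneg (fun a (ha : a ∈ T) => (hD.mem x).1 hxP a (hT ha))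
    linarith
  · ext x
    simp only [hx]
    constructor
    · rintro ⟨h1, h2⟩
      refine ⟨(hD.mem x).2 h1, ?_⟩
      rw [hf (x, 1), Finset.sum_eq_zero h2, sub_zero]
    · rintro ⟨h1, h2⟩
      have h1' := (hD.mem x).1 h1
      refine ⟨h1', ?_⟩
      apply (Finset.sum_eq_zero_iff_of_nonneg (fun a (ha : a ∈ T) => h1' a (hT ha))).1
      rw [← hf]; linarith

/-- moving a bit from a realising point -/
lemma ev_cone {w v : (Fin n → ℝ) × ℝ} (hw : ∀ a ∈ A, 0 ≤ a w) (hv : ∀ a ∈ tt A w, a v = 0) :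
    ∀ᶠ t in 𝓝 (0:ℝ), ∀ a ∈ A, 0 ≤ a (w + t • v) := by
  rw [Filter.eventually_all_finset]
  intro a ha
  by_cases h : a w = 0
  · apply Filter.Eventually.of_forall
    intro t
    simp [h, hv a (mem_tt.2 ⟨ha, h⟩)]
  · filter_upwards [ev_lin (a v) (lt_of_le_of_ne (hw a ha) (Ne.symm h))] with t ht
    simpa using ht.le

lemma Desc.face_phi (hD : Desc P A) {F : Set (Fin n → ℝ)} (hF : IsPolytopeFace P F) :
    ∃ T, Real' A T ∧ F = Phi A T := by
  rcases F.eq_empty_or_nonempty with rfl | hne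
  · exact ⟨A, ⟨0, by simp, by simp [tt]⟩, hD.phi_full.symm⟩
  rcases hF with rfl | ⟨f, b, hb, hF⟩
  · exact absurd hne (by simp)
  obtain ⟨y, hy, hmin⟩ : ∃ y ∈ F, ∀ x ∈ F, (tt A (y, 1)).card ≤ (tt A (x, 1)).card := by
    obtain ⟨y, hy, h⟩ := (measure fun x : Fin n → ℝ => (tt A (x, 1)).card).wf.has_min F hne
    exact ⟨y, hy, fun x hx => not_lt.1 (h x hx)⟩
  have hF' : ∀ x, x ∈ F ↔ x ∈ P ∧ ∑ i, f i * x i = b := fun x => by rw [hF]; rfl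
  have hyP := (hD.mem y).1 ((hF' y).1 hy).1
  refine ⟨tt A (y, 1), ⟨(y, 1), hyP, rfl⟩, ?_⟩
  ext x
  constructor
  · intro hx
    have hxP := (hD.mem x).1 ((hF' x).1 hx).1
    refine ⟨hxP, ?_⟩
    let m : Fin n → ℝ := (1/2 : ℝ) • x + (1/2 : ℝ) • y
    have hm : ((m, 1) : (Fin n → ℝ) × ℝ) = (1/2 : ℝ) • (x, 1) + (1/2 : ℝ) • (y, 1) := by
      ext1
      · simp [m]
      · simp; norm_num
    have ham : ∀ a : ((Fin n → ℝ) × ℝ) →ₗ[ℝ] ℝ, a (m, 1) = 1/2 * a (x, 1) + 1/2 * a (y, 1) := by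
      intro a; rw [hm, map_add, map_smul, map_smul, smul_eq_mul, smul_eq_mul]
    have hmF : m ∈ F := by
      rw [hF', hD.mem]
      refine ⟨fun a ha => ?_, ?_⟩
      · have := hxP a ha
        have := hyP a ha
        rw [ham]; linarith
      · have h1 := ((hF' x).1 hx).2
        have h2 := ((hF' y).1 hy).2
        have : ∑ i, f i * m i = 1/2 * ∑ i, f i * x i + 1/2 * ∑ i, f i * y i := by
          rw [Finset.mul_sum, Finset.mul_sum, ← Finset.sum_add_distrib]
          apply Finset.sum_congr rfl
          intro i _
          simp [m]; ring
        rw [this, h1, h2]; ring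
    have hsub : tt A (m, 1) ⊆ tt A (y, 1) := by
      intro a ha
      obtain ⟨ha, h0⟩ := mem_tt.1 ha
      rw [ham] at h0
      have := hxP a ha
      have := hyP a ha
      exact mem_tt.2 ⟨ha, by linarith⟩
    have heq := Finset.eq_of_subset_of_card_le hsub (hmin m hmF)
    intro a ha
    rw [← heq] at ha
    obtain ⟨ha, h0⟩ := mem_tt.1 ha
    rw [ham] at h0
    have := hxP a ha
    have := hyP a ha
    linarith
  · rintro ⟨hxP, hx⟩
    have hxP' := (hD.mem x).2 hxP
    have hv : ∀ a ∈ tt A (y, 1), a ((y, 1) - (x, 1)) = 0 := by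
      intro a ha
      rw [map_sub, hx a ha, (mem_tt.1 ha).2, sub_zero]
    obtain ⟨t, ht, h1, -⟩ := ev_pos (ev_cone hyP hv)
    have e : ((y, 1) : (Fin n → ℝ) × ℝ) + t • ((y, 1) - (x, 1)) = (y + t • (y - x), 1) := by
      ext1 <;> simp
    rw [e] at h1
    have h2 := hb _ ((hD.mem _).2 h1)
    have h3 : ∑ i, f i * (y + t • (y - x)) i = b + t * (b - ∑ i, f i * x i) := by
      have : ∀ i, f i * (y + t • (y - x)) i = f i * y i + t * (f i * y i - f i * x i) := by
        intro i; simp; ring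
      simp only [this, Finset.sum_add_distrib, ← Finset.mul_sum, Finset.sum_sub_distrib,
        ((hF' y).1 hy).2]
    rw [h3] at h2
    have h4 : b - ∑ i, f i * x i ≤ 0 := by
      by_contra hc
      push Not at hc
      have := mul_pos ht hc
      linarith
    exact (hF' x).2 ⟨hxP', le_antisymm (hb x hxP') (by linarith)⟩

lemma Desc.dim_phi (hD : Desc P A) {T : Finset (((Fin n → ℝ) × ℝ) →ₗ[ℝ] ℝ)} (h : Real' A T) :
    faceDim' (Phi A T) = (Module.finrank ℝ (kerAll T) : ℤ) - 1 := by
  rcases hD.real_cases h with rfl | ⟨y, hy, hT⟩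
  · rw [hD.phi_full, faceDim', if_pos rfl]
    have : kerAll T = ⊥ := by
      rw [eq_bot_iff]
      intro w hw
      have h1 := hD.cone w (fun a ha => (hw a ha).ge)
      have h2 := hD.cone (-w) (fun a ha => by rw [map_neg, hw a ha, neg_zero])
      rcases h1 with h1 | ⟨s, hs, x, -, h1⟩
      · exact h1
      rcases h2 with h2 | ⟨s', hs', x', -, h2⟩
      · simpa using h2
      have h3 := congrArg Prod.snd h1
      have h4 := congrArg Prod.snd h2
      simp at h3 h4
      linarith
    rw [this]; simp
  · have hyT : y ∈ Phi A T := ⟨hy, fun a ha => by rw [← hT] at ha; exact (mem_tt.1 ha).2⟩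
    have hne : Phi A T ≠ ∅ := Set.nonempty_iff_ne_empty.1 ⟨y, hyT⟩
    rw [faceDim', if_neg hne]
    have hk := finrank_inf_ker (kerAll T) (LinearMap.snd ℝ (Fin n → ℝ) ℝ) (u := (y, 1))
      (fun a ha => hyT.2 a ha) (by simp)
    have hmap : kerAll T ⊓ LinearMap.ker (LinearMap.snd ℝ (Fin n → ℝ) ℝ)
        = ((affineSpan ℝ (Phi A T)).direction).map (LinearMap.inl ℝ (Fin n → ℝ) ℝ) := by
      rw [direction_affineSpan]
      apply le_antisymm
      · rintro ⟨v, r⟩ ⟨hv, hr⟩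
        have hr' : r = 0 := hr
        subst hr'
        refine ⟨v, ?_, rfl⟩
        obtain ⟨t, ht, h1, -⟩ := ev_pos (ev_cone hy (v := (v, 0)) (by rw [hT]; exact hv))
        have e : ((y, 1) : (Fin n → ℝ) × ℝ) + t • (v, 0) = (y + t • v, 1) := by
          ext1 <;> simp
        have hm : y + t • v ∈ Phi A T := by
          rw [e] at h1
          refine ⟨h1, fun a ha => ?_⟩
          rw [← e, map_add, map_smul, hyT.2 a ha, hv a ha]; simp
        have := vsub_mem_vectorSpan ℝ hm hyT
        simp only [vsub_eq_sub, add_sub_cancel_left] at this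
        have h2 := Submodule.smul_mem _ t⁻¹ this
        rwa [smul_smul, inv_mul_cancel₀ ht.ne', one_smul] at h2
      · rw [Submodule.map_le_iff_le_comap, vectorSpan_def, Submodule.span_le]
        rintro _ ⟨p, hp, q, hq, rfl⟩
        refine ⟨?_, ?_⟩
        · intro a ha
          have : (LinearMap.inl ℝ (Fin n → ℝ) ℝ) (p -ᵥ q) = (p, 1) - (q, 1) := by
            ext1 <;> simp
          rw [this, map_sub, hp.2 a ha, hq.2 a ha, sub_zero]
        · simp
    rw [hmap, ← LinearEquiv.finrank_eq
      (Submodule.equivMapOfInjective _ LinearMap.inl_injective _)] at hk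
    rw [← hk]; push_cast; ring

lemma sum_interval {TG TF : Finset (((Fin n → ℝ) × ℝ) →ₗ[ℝ] ℝ)} (hG : Real' A TG)
    (hF : Real' A TF) (hs : TF ⊂ TG) :
    ∑ T ∈ A.powerset.filter (fun T => Real' A T ∧ TF ⊆ T ∧ T ⊆ TG),
      (-1 : ℤ) ^ (Module.finrank ℝ (kerAll T)) = 0 := by
  obtain ⟨g, hg, hgT⟩ := hG
  obtain ⟨x, hx, hxT⟩ := hF
  have hTGA : TG ⊆ A := Real'.sub ⟨g, hg, hgT⟩
  have hTFA : TF ⊆ A := Real'.sub ⟨x, hx, hxT⟩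
  have hJ : ∀ a ∈ TG \ TF, 0 < a x := by
    intro a ha
    obtain ⟨h1, h2⟩ := Finset.mem_sdiff.1 ha
    refine lt_of_le_of_ne (hx a (hTGA h1)) fun h => h2 ?_
    rw [← hxT]; exact mem_tt.2 ⟨hTGA h1, h.symm⟩
  have hxU : x ∈ kerAll TF := by
    intro a ha; rw [← hxT] at ha; exact (mem_tt.1 ha).2
  have key := sum_cells (kerAll TF) hxU hJ
    (Finset.sdiff_nonempty.2 (Finset.ssubset_iff_subset_ne.1 hs |>.2 <| hs.1.antisymm ·))
  rw [← key]
  have hreal : ∀ T, TF ⊆ T → T ⊆ TG →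
      (Real' A T ↔ (cellOf (kerAll TF) (TG \ TF) (T \ TF)).Nonempty) := by
    intro T h1 h2
    constructor
    · rintro ⟨w, hw, rfl⟩
      refine ⟨w, fun a ha => (mem_tt.1 (h1 ha)).2,
        fun a ha => (mem_tt.1 (Finset.mem_sdiff.1 ha).1).2, fun a ha => ?_⟩
      simp only [Finset.mem_sdiff, not_and, not_not] at ha
      refine lt_of_le_of_ne (hw a (hTGA ha.1.1)) fun h => ha.1.2 (ha.2 (mem_tt.2 ⟨hTGA ha.1.1, h.symm⟩))
    · rintro ⟨w, hw1, hw2, hw3⟩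
      have hgp : ∀ a ∈ A \ TG, 0 < a g := by
        intro a ha
        obtain ⟨h1, h2⟩ := Finset.mem_sdiff.1 ha
        refine lt_of_le_of_ne (hg a h1) fun h => h2 ?_
        rw [← hgT]; exact mem_tt.2 ⟨h1, h.symm⟩
      obtain ⟨t, ht, h4, -⟩ := ev_pos ((Filter.eventually_all_finset (A \ TG)).2 fun a ha =>
        ev_lin (a w) (hgp a ha))
      have hz : ∀ a ∈ T, a (g + t • w) = 0 := by
        intro a ha
        have hag : a g = 0 := by
          have := h2 ha
          rw [← hgT] at this; exact (mem_tt.1 this).2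
        have haw : a w = 0 := by
          by_cases hF : a ∈ TF
          · exact hw1 a hF
          · exact hw2 a (Finset.mem_sdiff.2 ⟨ha, hF⟩)
        simp [hag, haw]
      have hp : ∀ a ∈ A, a ∉ T → 0 < a (g + t • w) := by
        intro a ha haT
        by_cases haG : a ∈ TG
        · have hag : a g = 0 := by
            rw [← hgT] at haG; exact (mem_tt.1 haG).2
          have : 0 < a w := hw3 a (by
            simp only [Finset.mem_sdiff, not_and, not_not]
            exact ⟨⟨haG, fun h => haT (h1 h)⟩, fun h => absurd h haT⟩)
          rw [map_add, map_smul, hag, zero_add]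
          exact mul_pos ht this
        · simpa using h4 a (Finset.mem_sdiff.2 ⟨ha, haG⟩)
      refine ⟨g + t • w, fun a ha => ?_, ?_⟩
      · by_cases haT : a ∈ T
        · exact (hz a haT).ge
        · exact (hp a ha haT).le
      · ext a
        rw [mem_tt]
        constructor
        · rintro ⟨ha, h0⟩
          by_contra haT
          exact (hp a ha haT).ne' h0
        · exact fun ha => ⟨hTGA (h2 ha), hz a ha⟩
  symm
  have hfil : ∑ T ∈ (TG \ TF).powerset, eul (cellOf (kerAll TF) (TG \ TF) T)
      = ∑ T ∈ (TG \ TF).powerset.filter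
        (fun T => (cellOf (kerAll TF) (TG \ TF) T).Nonempty),
          eul (cellOf (kerAll TF) (TG \ TF) T) := by
    symm
    apply Finset.sum_filter_of_ne
    intro T _ hne
    by_contra hc
    rw [Set.not_nonempty_iff_eq_empty] at hc
    rw [hc, eul_empty] at hne
    exact hne rfl
  rw [hfil]
  have hsd : ∀ S ⊆ TG \ TF, (TF ∪ S) \ TF = S := by
    intro S hS
    ext a
    have := @hS a
    simp only [Finset.mem_sdiff, Finset.mem_union] at this ⊢
    tauto
  refine Finset.sum_bij' (fun S _ => TF ∪ S) (fun T _ => T \ TF) ?_ ?_ ?_ ?_ ?_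
  · intro S hS
    rw [Finset.mem_filter, Finset.mem_powerset] at hS
    have h2 : TF ∪ S ⊆ TG := Finset.union_subset hs.1 (hS.1.trans Finset.sdiff_subset)
    rw [Finset.mem_filter, Finset.mem_powerset, hreal _ Finset.subset_union_left h2, hsd S hS.1]
    exact ⟨h2.trans hTGA, hS.2, Finset.subset_union_left, h2⟩
  · intro T hT
    rw [Finset.mem_filter] at hT
    obtain ⟨-, h1, h2, h3⟩ := hT
    rw [Finset.mem_filter, Finset.mem_powerset]
    exact ⟨Finset.sdiff_subset_sdiff h3 le_rfl, (hreal T h2 h3).1 h1⟩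
  · intro S hS
    rw [Finset.mem_filter, Finset.mem_powerset] at hS
    exact hsd S hS.1
  · intro T hT
    rw [Finset.mem_filter] at hT
    exact Finset.union_sdiff_of_subset hT.2.2.1
  · intro S hS
    rw [Finset.mem_filter, Finset.mem_powerset] at hS
    rw [(isCell_cellOf _ _ _).eul_eq hS.2]
    have : kerAll TF ⊓ kerAll S = kerAll (TF ∪ S) := by
      ext w
      simp only [Submodule.mem_inf, mem_kerAll, Finset.mem_union]
      constructor
      · rintro ⟨h1, h2⟩ a (ha | ha)
        · exact h1 a ha
        · exact h2 a ha
      · exact fun h => ⟨fun a ha => h a (Or.inl ha), fun a ha => h a (Or.inr ha)⟩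
    rw [this]

end Poly

/-- **The Möbius function of the face lattice of a polytope.** Let `P ⊂ ℝ^n` be a polytope
and let `Fcs` be the (finite) collection of all faces of `P`, including `∅` and `P`, ordered
by inclusion. Then the Möbius function of this poset satisfies
`μ(G, F) = (-1)^{dim F - dim G}` for all faces `G ⊆ F`, where `dim ∅ = -1`. -/
theorem polytope_face_moebius (n : ℕ) (Vs : Finset (Fin n → ℝ)) (P : Set (Fin n → ℝ))
    (hP : P = convexHull ℝ (Vs : Set (Fin n → ℝ)))
    (Fcs : Finset (Set (Fin n → ℝ)))
    (hFcs : ∀ F, F ∈ Fcs ↔ IsPolytopeFace P F)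
    (μ : Set (Fin n → ℝ) → Set (Fin n → ℝ) → ℤ)
    (hμ0 : ∀ G ∈ Fcs, ∀ F ∈ Fcs, ¬ G ⊆ F → μ G F = 0)
    (hμ1 : ∀ F ∈ Fcs, μ F F = 1)
    (hμ2 : ∀ G ∈ Fcs, ∀ F ∈ Fcs, G ⊂ F →
      μ G F = -∑ z ∈ Fcs.filter (fun z => G ⊆ z ∧ z ⊂ F), μ G z) :
    ∀ G ∈ Fcs, ∀ F ∈ Fcs, G ⊆ F →
      μ G F = (-1) ^ ((faceDim' F - faceDim' G).toNat) := by
  subst hP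
  obtain ⟨A, hD⟩ := exists_desc Vs
  have hsel : ∀ F, ∃ T, F ∈ Fcs → Real' A T ∧ F = Phi A T := by
    intro F
    by_cases hF : F ∈ Fcs
    · obtain ⟨T, hT⟩ := hD.face_phi ((hFcs F).1 hF)
      exact ⟨T, fun _ => hT⟩
    · exact ⟨∅, fun h => absurd h hF⟩
  choose τ hτ using hsel
  have hsub : ∀ G ∈ Fcs, ∀ F ∈ Fcs, (G ⊆ F ↔ τ F ⊆ τ G) := by
    intro G hG F hF
    rw [← hD.phi_sub (hτ G hG).1 (hτ F hF).1, ← (hτ G hG).2, ← (hτ F hF).2]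
  let D : Set (Fin n → ℝ) → ℕ := fun F => Module.finrank ℝ (kerAll (τ F))
  have hdim : ∀ F ∈ Fcs, faceDim' F = (D F : ℤ) - 1 := by
    intro F hF
    conv_lhs => rw [(hτ F hF).2]
    exact hD.dim_phi (hτ F hF).1
  have hsign : ∀ G ∈ Fcs, ∀ F ∈ Fcs, G ⊆ F →
      (-1 : ℤ) ^ ((faceDim' F - faceDim' G).toNat) = (-1) ^ (D F) * (-1) ^ (D G) := by
    intro G hG F hF h
    have hle : D G ≤ D F := by
      apply Submodule.finrank_mono
      intro w hw a ha
      exact hw a ((hsub G hG F hF).1 h ha)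
    rw [hdim G hG, hdim F hF]
    have : ((D F : ℤ) - 1 - ((D G : ℤ) - 1)).toNat = D F - D G := by omega
    rw [this]
    obtain ⟨k, hk⟩ := Nat.exists_eq_add_of_le hle
    rw [hk, Nat.add_sub_cancel_left, pow_add, mul_comm, ← mul_assoc, ← mul_pow]
    simp
  have hsum : ∀ G ∈ Fcs, ∀ F ∈ Fcs, G ⊂ F →
      ∑ z ∈ Fcs.filter (fun z => G ⊆ z ∧ z ⊆ F), (-1 : ℤ) ^ (D z) = 0 := by
    intro G hG F hF h
    have hss : τ F ⊂ τ G := by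
      refine ⟨(hsub G hG F hF).1 h.1, fun h' => h.2 ((hsub F hF G hG).2 h')⟩
    rw [← sum_interval (hτ G hG).1 (hτ F hF).1 hss]
    have hphi : ∀ T, Real' A T → Phi A T ∈ Fcs ∧ τ (Phi A T) = T := by
      intro T hT
      have h1 : Phi A T ∈ Fcs := (hFcs _).2 (hD.phi_face hT.sub)
      refine ⟨h1, ?_⟩
      have h2 := hτ _ h1
      apply le_antisymm
      · exact (hD.phi_sub hT h2.1).1 h2.2.le
      · exact (hD.phi_sub h2.1 hT).1 h2.2.ge
    refine Finset.sum_bij' (fun z _ => τ z) (fun T _ => Phi A T) ?_ ?_ ?_ ?_ ?_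
    · intro z hz
      obtain ⟨hz, h1, h2⟩ := Finset.mem_filter.1 hz
      rw [Finset.mem_filter, Finset.mem_powerset]
      exact ⟨(hτ z hz).1.sub, (hτ z hz).1, (hsub z hz F hF).1 h2, (hsub G hG z hz).1 h1⟩
    · intro T hT
      obtain ⟨-, hT, h1, h2⟩ := Finset.mem_filter.1 hT
      obtain ⟨h3, h4⟩ := hphi T hT
      rw [Finset.mem_filter, hsub _ hG _ h3, hsub _ h3 _ hF, h4]
      exact ⟨h3, h2, h1⟩
    · intro z hz
      exact ((hτ z (Finset.mem_filter.1 hz).1).2).symm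
    · intro T hT
      exact (hphi T (Finset.mem_filter.1 hT).2.1).2
    · intro z hz
      rfl
  intro G hG
  have main : ∀ k : ℕ, ∀ F ∈ Fcs, (Fcs.filter (fun z => z ⊂ F)).card = k → G ⊆ F →
      μ G F = (-1) ^ (D F) * (-1) ^ (D G) := by
    intro k
    induction k using Nat.strong_induction_on with
    | _ k ih =>
      intro F hF hk hGF
      by_cases hEq : G = F
      · subst hEq
        rw [hμ1 G hG, ← mul_pow]; simp
      have hss : G ⊂ F := Set.ssubset_iff_subset_ne.2 ⟨hGF, hEq⟩
      rw [hμ2 G hG F hF hss]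
      have h1 : ∀ z ∈ Fcs.filter (fun z => G ⊆ z ∧ z ⊂ F),
          μ G z = (-1) ^ (D z) * (-1) ^ (D G) := by
        intro z hz
        obtain ⟨hz, h1, h2⟩ := Finset.mem_filter.1 hz
        refine ih _ ?_ z hz rfl h1
        rw [← hk]
        apply Finset.card_lt_card
        refine ⟨fun y hy => ?_, fun hc => ?_⟩
        · obtain ⟨hy, h3⟩ := Finset.mem_filter.1 hy
          exact Finset.mem_filter.2 ⟨hy, h3.trans h2⟩
        · exact (ssubset_irrefl z (Finset.mem_filter.1 (hc (Finset.mem_filter.2 ⟨hz, h2⟩))).2)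
      rw [Finset.sum_congr rfl h1, ← Finset.sum_mul]
      have h2 : Fcs.filter (fun z => G ⊆ z ∧ z ⊆ F)
          = insert F (Fcs.filter (fun z => G ⊆ z ∧ z ⊂ F)) := by
        ext z
        simp only [Finset.mem_insert, Finset.mem_filter]
        constructor
        · rintro ⟨hz, h1, h2⟩
          by_cases hzF : z = F
          · exact Or.inl hzF
          · exact Or.inr ⟨hz, h1, Set.ssubset_iff_subset_ne.2 ⟨h2, hzF⟩⟩
        · rintro (rfl | ⟨hz, h1, h2⟩)
          · exact ⟨hF, hGF, le_rfl⟩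
          · exact ⟨hz, h1, h2.1⟩
      have h3 := hsum G hG F hF hss
      rw [h2, Finset.sum_insert (by simp [ssubset_irrefl])] at h3
      rw [eq_neg_of_add_eq_zero_left h3]
      ring
  intro F hF hGF
  rw [hsign G hG F hF hGF]
  exact main _ F hF rfl hGF
end
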